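/- Let u ∈ L^∞ and p ∈ L¹ be a space-time weak solution to the incompressible Euler equations ∂_t u + div(u⊗u) + ∇p = f, div u = 0 on Ω × (0,T) with f ∈ L¹, and assume the spatial symmetric gradient Eu = (∇u + ∇uᵀ)/2 (distributional in space-time) is a finite matrix-valued Radon measure. Then the Duchon–Robert distribution D defined by ∂_t(|u|²/2) + div((|u|²/2 + p)u) = −D + f·u is a Radon measure, and locally there is C > 0 such that |D| ≤ C |E^s u| as measures, where E^s u is the singular part of Eu with respect to Lebesgue measure ℒ^{d+1}. -/

import Mathlib

open MeasureTheory
open scoped RealInnerProductSpace ContDiff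

noncomputable section

variable {d : ℕ}

/-- Integral of a function against a signed measure, via the Jordan decomposition. -/
def sintegral {α : Type*} [MeasurableSpace α] (φ : α → ℝ) (s : SignedMeasure α) : ℝ :=
  (∫ x, φ x ∂s.toJordanDecomposition.posPart) - ∫ x, φ x ∂s.toJordanDecomposition.negPart

/-- Spatial partial derivative `∂_i` of a space-time scalar function. -/
def dX (i : Fin d) (ψ : EuclideanSpace ℝ (Fin d) × ℝ → ℝ)
    (z : EuclideanSpace ℝ (Fin d) × ℝ) : ℝ :=
  fderiv ℝ ψ z (EuclideanSpace.single i 1, 0)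

/-- Time partial derivative `∂_t` of a space-time scalar function. -/
def dT (ψ : EuclideanSpace ℝ (Fin d) × ℝ → ℝ) (z : EuclideanSpace ℝ (Fin d) × ℝ) : ℝ :=
  fderiv ℝ ψ z (0, 1)

/-- A space-time test function supported in `Ω × (0,T)`. -/
def IsTest (Ω : Set (EuclideanSpace ℝ (Fin d))) (T : ℝ)
    (ψ : EuclideanSpace ℝ (Fin d) × ℝ → ℝ) : Prop :=
  ContDiff ℝ ∞ ψ ∧ HasCompactSupport ψ ∧ tsupport ψ ⊆ Ω ×ˢ Set.Ioo 0 T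


section SI
variable {α : Type*} [MeasurableSpace α]

lemma sintegral_eq_of_sub {μ₁ μ₂ : Measure α} [IsFiniteMeasure μ₁] [IsFiniteMeasure μ₂]
    {s : SignedMeasure α} (h : s = μ₁.toSignedMeasure - μ₂.toSignedMeasure) {φ : α → ℝ}
    (hφ : Measurable φ) {B : ℝ} (hB : ∀ x, |φ x| ≤ B) :
    sintegral φ s = (∫ x, φ x ∂μ₁) - ∫ x, φ x ∂μ₂ := by
  have hIntg : ∀ μ : Measure α, IsFiniteMeasure μ → Integrable φ μ := fun μ _ =>
    Integrable.of_bound hφ.aestronglyMeasurable B (Filter.Eventually.of_forall hB)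
  have h1 : s.toJordanDecomposition.posPart + μ₂ = s.toJordanDecomposition.negPart + μ₁ := by
    have h2 := s.toSignedMeasure_toJordanDecomposition
    rw [JordanDecomposition.toSignedMeasure] at h2
    ext A hA
    have h3 : s A = s.toJordanDecomposition.posPart.real A
        - s.toJordanDecomposition.negPart.real A := by
      conv_lhs => rw [← h2]
      exact Measure.toSignedMeasure_sub_apply hA
    have h4 : s A = μ₁.real A - μ₂.real A := by
      rw [h]; exact Measure.toSignedMeasure_sub_apply hA
    rw [← ENNReal.toReal_eq_toReal_iff' (measure_ne_top _ _) (measure_ne_top _ _)]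
    change Measure.real _ _ = Measure.real _ _
    rw [measureReal_add_apply, measureReal_add_apply]
    linarith
  have h5 := congrArg (fun μ => ∫ x, φ x ∂μ) h1
  rw [integral_add_measure (hIntg _ inferInstance) (hIntg _ inferInstance),
    integral_add_measure (hIntg _ inferInstance) (hIntg _ inferInstance)] at h5
  unfold sintegral
  linarith

lemma sintegral_add {s t : SignedMeasure α} {φ : α → ℝ}
    (hφ : Measurable φ) {B : ℝ} (hB : ∀ x, |φ x| ≤ B) :
    sintegral φ (s + t) = sintegral φ s + sintegral φ t := by
  have hIntg : ∀ μ : Measure α, IsFiniteMeasure μ → Integrable φ μ := fun μ _ =>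
    Integrable.of_bound hφ.aestronglyMeasurable B (Filter.Eventually.of_forall hB)
  have hs := s.toSignedMeasure_toJordanDecomposition
  have ht := t.toSignedMeasure_toJordanDecomposition
  rw [JordanDecomposition.toSignedMeasure] at hs ht
  have h : s + t = (s.toJordanDecomposition.posPart + t.toJordanDecomposition.posPart).toSignedMeasure
      - (s.toJordanDecomposition.negPart + t.toJordanDecomposition.negPart).toSignedMeasure := by
    rw [Measure.toSignedMeasure_add, Measure.toSignedMeasure_add]
    conv_lhs => rw [← hs, ← ht]
    abel
  rw [sintegral_eq_of_sub h hφ hB,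
    integral_add_measure (hIntg _ inferInstance) (hIntg _ inferInstance),
    integral_add_measure (hIntg _ inferInstance) (hIntg _ inferInstance)]
  unfold sintegral
  ring

lemma sintegral_withDensity {μ : Measure α} {g : α → ℝ} (hg : Integrable g μ) {φ : α → ℝ}
    (hφ : Measurable φ) {B : ℝ} (hB : ∀ x, |φ x| ≤ B) :
    sintegral φ (μ.withDensityᵥ g) = ∫ x, φ x * g x ∂μ := by
  have h1 : IsFiniteMeasure (μ.withDensity fun x => ENNReal.ofReal (g x)) :=
    isFiniteMeasure_withDensity_ofReal hg.2
  have h2 : IsFiniteMeasure (μ.withDensity fun x => ENNReal.ofReal (-g x)) :=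
    isFiniteMeasure_withDensity_ofReal hg.neg.2
  have hm : ∀ k : α → ℝ, Integrable k μ → Integrable (fun x => φ x * k x) μ := fun k hk =>
    hk.bdd_mul hφ.aestronglyMeasurable (c := B) (Filter.Eventually.of_forall hB)
  rw [sintegral_eq_of_sub (withDensityᵥ_eq_withDensity_pos_part_sub_withDensity_neg_part hg) hφ hB,
    integral_withDensity_eq_integral_toReal_smul₀ hg.1.aemeasurable.ennreal_ofReal
      (Filter.Eventually.of_forall fun x => ENNReal.ofReal_lt_top),
    integral_withDensity_eq_integral_toReal_smul₀ (f := fun x => ENNReal.ofReal (-g x))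
      hg.neg.1.aemeasurable.ennreal_ofReal
      (Filter.Eventually.of_forall fun x => ENNReal.ofReal_lt_top), ← integral_sub]
  · congr 1
    ext x
    simp only [smul_eq_mul, ENNReal.toReal_ofReal']
    rw [← sub_mul, max_zero_sub_max_neg_zero_eq_self, mul_comm]
  · simpa [ENNReal.toReal_ofReal', mul_comm] using hm _ hg.pos_part
  · simpa [ENNReal.toReal_ofReal', mul_comm] using hm _ hg.neg_part

lemma abs_sintegral_le (s : SignedMeasure α) {φ : α → ℝ}
    (hφ : Measurable φ) {B : ℝ} (hB : ∀ x, |φ x| ≤ B) :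
    |sintegral φ s| ≤ ∫ x, |φ x| ∂s.totalVariation := by
  have hIntg : ∀ μ : Measure α, IsFiniteMeasure μ → Integrable φ μ := fun μ _ =>
    Integrable.of_bound hφ.aestronglyMeasurable B (Filter.Eventually.of_forall hB)
  rw [SignedMeasure.totalVariation,
    integral_add_measure (hIntg _ inferInstance).abs (hIntg _ inferInstance).abs]
  unfold sintegral
  refine (abs_sub _ _).trans (add_le_add ?_ ?_) <;> exact abs_integral_le_integral_abs

lemma totalVariation_le_of {μ : Measure α} [IsFiniteMeasure μ] {s : SignedMeasure α} (C : NNReal)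
    (h : ∀ A, MeasurableSet A → |s A| ≤ C * μ.real A) {A : Set α} (hA : MeasurableSet A) :
    s.totalVariation A ≤ C * μ A := by
  obtain ⟨i, hi₁, hi₂, hi₃, hp, hn⟩ := s.toJordanDecomposition_spec
  have key : ∀ A, MeasurableSet A → ENNReal.ofReal |s A| ≤ C * μ A := by
    intro A hA
    refine (ENNReal.ofReal_le_ofReal (h A hA)).trans_eq ?_
    rw [ENNReal.ofReal_mul C.coe_nonneg, ENNReal.ofReal_coe_nnreal]
    simp [Measure.real, ENNReal.ofReal_toReal]
  rw [SignedMeasure.totalVariation, Measure.add_apply, hp, hn]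
  have h1 : s.toMeasureOfZeroLE i hi₁ hi₂ A ≤ ENNReal.ofReal |s (i ∩ A)| := by
    rw [SignedMeasure.toMeasureOfZeroLE_apply _ _ _ hA, ENNReal.ofReal, ENNReal.coe_le_coe,
      ← NNReal.coe_le_coe]
    simpa using le_abs_self _
  have h2 : s.toMeasureOfLEZero iᶜ hi₁.compl hi₃ A ≤ ENNReal.ofReal |s (iᶜ ∩ A)| := by
    rw [SignedMeasure.toMeasureOfLEZero_apply _ _ _ hA, ENNReal.ofReal, ENNReal.coe_le_coe,
      ← NNReal.coe_le_coe]
    simpa using neg_le_abs _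
  refine (add_le_add (h1.trans (key _ (hi₁.inter hA)))
    (h2.trans (key _ (hi₁.compl.inter hA)))).trans_eq ?_
  rw [← mul_add, Set.inter_comm i, Set.inter_comm iᶜ, ← Set.sdiff_eq,
    measure_inter_add_sdiff _ hi₁]

/-- Hahn-Banach plus Riesz: a functional dominated by an `L¹(μ)` norm is a signed measure. -/
lemma exists_signed {μ : Measure α} [IsFiniteMeasure μ] (C : NNReal)
    (V : Submodule ℝ (α → ℝ)) (hV : ∀ φ ∈ V, Measurable φ ∧ ∃ B, ∀ x, |φ x| ≤ B)
    (L : V →ₗ[ℝ] ℝ) (hL : ∀ φ : V, L φ ≤ C * ∫ x, |(φ : α → ℝ) x| ∂μ) :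
    ∃ s : SignedMeasure α, (∀ φ : V, L φ = sintegral φ s) ∧
      ∀ A, MeasurableSet A → |s A| ≤ C * μ.real A := by
  let E : Submodule ℝ (α → ℝ) :=
    { carrier := {φ | Integrable φ μ}
      add_mem' := fun h1 h2 => Integrable.add h1 h2
      zero_mem' := integrable_zero _ _ _
      smul_mem' := fun c _ h => Integrable.smul c h }
  have hVE : V ≤ E := by
    intro φ hφ
    obtain ⟨h1, B, h2⟩ := hV φ hφ
    exact Integrable.of_bound h1.aestronglyMeasurable B (Filter.Eventually.of_forall h2)
  let f : E →ₗ.[ℝ] ℝ :=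
    { domain := V.comap E.subtype
      toFun := L.comp ((E.subtype.comp (V.comap E.subtype).subtype).codRestrict V
        (fun x => x.2)) }
  obtain ⟨g, hg1, hg2⟩ := exists_extension_of_le_sublinear f
    (fun φ => C * ∫ x, |(φ : α → ℝ) x| ∂μ)
    (by
      intro c hc x
      simp only [Submodule.coe_smul, Pi.smul_apply, smul_eq_mul, abs_mul, abs_of_pos hc,
        integral_const_mul]
      ring)
    (by
      intro x y
      rw [← mul_add, ← integral_add x.2.abs y.2.abs]
      refine mul_le_mul_of_nonneg_left ?_ C.2
      refine integral_mono (x.2.add y.2).abs (x.2.abs.add y.2.abs) fun z => ?_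
      exact abs_add_le _ _)
    (fun x => hL ⟨((x : E) : α → ℝ), x.2⟩)
  have hgabs : ∀ φ : E, |g φ| ≤ C * ∫ x, |(φ : α → ℝ) x| ∂μ := by
    intro φ
    refine abs_le.2 ⟨?_, hg2 φ⟩
    have := hg2 (-φ)
    simp only [map_neg, Submodule.coe_neg, Pi.neg_apply, abs_neg] at this
    linarith
  have hind : ∀ A, MeasurableSet A → Integrable (A.indicator (fun _ => (1 : ℝ))) μ :=
    fun A hA => (integrable_const 1).indicator hA
  classical
  let s : SignedMeasure α :=
    { measureOf' := fun A => if hA : MeasurableSet A then g ⟨_, hind A hA⟩ else 0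
      empty' := by
        simp only [MeasurableSet.empty, dif_pos]
        have : (⟨_, hind ∅ MeasurableSet.empty⟩ : E) = 0 := by
          ext x; simp
        rw [this, map_zero]
      not_measurable' := fun A hA => by simp [hA]
      m_iUnion' := by
        intro F hF hd
        simp only [hF, MeasurableSet.iUnion hF, dif_pos]
        have hs : HasSum (fun i => μ.real (F i)) (μ.real (⋃ i, F i)) := by
          have h1 := measure_iUnion hd hF (μ := μ)
          have h2 : ∑' i, μ (F i) ≠ ⊤ := by rw [← h1]; exact measure_ne_top _ _
          have h3 := (ENNReal.summable_toReal h2).hasSum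
          rwa [← ENNReal.tsum_toReal_eq (fun i => measure_ne_top _ _), ← h1] at h3
        rw [HasSum, tendsto_iff_norm_sub_tendsto_zero]
        rw [HasSum, ← tendsto_sub_nhds_zero_iff] at hs
        have hs' := (hs.neg.const_mul (C : ℝ))
        simp only [neg_zero, mul_zero] at hs'
        refine squeeze_zero (fun _ => norm_nonneg _) (fun t => ?_) hs'
        rw [← map_sum, ← map_sub, Real.norm_eq_abs]
        refine (hgabs _).trans (mul_le_mul_of_nonneg_left (le_of_eq ?_) C.2)
        have hpt : ∀ x, |((∑ i ∈ t, (⟨_, hind (F i) (hF i)⟩ : E) -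
            (⟨_, hind (⋃ i, F i) (MeasurableSet.iUnion hF)⟩ : E) : E) : α → ℝ) x|
            = (⋃ i, F i).indicator (fun _ => (1 : ℝ)) x
              - ∑ i ∈ t, (F i).indicator (fun _ => (1 : ℝ)) x := by
          intro x
          have hle : ∑ i ∈ t, (F i).indicator (fun _ => (1 : ℝ)) x
              ≤ (⋃ i, F i).indicator (fun _ => (1 : ℝ)) x := by
            rw [← Finset.indicator_biUnion_apply]
            · refine Set.indicator_le_indicator_of_subset ?_ (fun _ => zero_le_one) x
              intro y hy
              simp only [Set.mem_iUnion] at hy ⊢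
              obtain ⟨i, _, h⟩ := hy
              exact ⟨i, h⟩
            · intro i _ j _ hij
              exact hd hij
          simp only [Submodule.coe_sub, Submodule.coe_sum, Pi.sub_apply, Finset.sum_apply]
          rw [abs_sub_comm, abs_of_nonneg (sub_nonneg.2 hle)]
        rw [integral_congr_ae (Filter.Eventually.of_forall hpt), integral_sub
          (hind _ (MeasurableSet.iUnion hF)) (integrable_finsetSum _ fun i _ => hind _ (hF i)),
          integral_finsetSum _ fun i _ => hind _ (hF i)]
        simp only [integral_indicator_const _ (hF _),
          integral_indicator_const _ (MeasurableSet.iUnion hF), smul_eq_mul, mul_one]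
        ring }
  have hsA : ∀ A (hA : MeasurableSet A), s A = g ⟨_, hind A hA⟩ := fun A hA => dif_pos hA
  have hsb : ∀ A, MeasurableSet A → |s A| ≤ C * μ.real A := by
    intro A hA
    rw [hsA A hA]
    refine (hgabs _).trans_eq ?_
    congr 1
    have : ∀ x, |A.indicator (fun _ => (1 : ℝ)) x| = A.indicator (fun _ => (1 : ℝ)) x := fun x =>
      abs_of_nonneg (Set.indicator_nonneg (fun _ _ => zero_le_one) x)
    simp only [this]
    rw [integral_indicator_const _ hA, smul_eq_mul, mul_one]
  have htv : s.totalVariation ≤ C • μ := by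
    refine Measure.le_iff.2 fun A hA => ?_
    exact totalVariation_le_of C hsb hA
  have hle1 : s.toJordanDecomposition.posPart ≤ C • μ :=
    le_trans (Measure.le_add_right le_rfl) htv
  have hle2 : s.toJordanDecomposition.negPart ≤ C • μ :=
    le_trans (Measure.le_add_left le_rfl) htv
  have hCint : ∀ φ : α → ℝ, Integrable φ μ → Integrable φ (C • μ) :=
    fun φ h => h.smul_measure_nnreal
  have hsabs : ∀ φ : α → ℝ, Integrable φ μ → |sintegral φ s| ≤ C * ∫ x, |φ x| ∂μ := by
    intro φ hφ
    have h1 : |sintegral φ s| ≤ ∫ x, |φ x| ∂s.totalVariation := by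
      rw [SignedMeasure.totalVariation, integral_add_measure
        ((hCint _ hφ).mono_measure hle1).abs ((hCint _ hφ).mono_measure hle2).abs]
      unfold sintegral
      refine (abs_sub _ _).trans (add_le_add ?_ ?_) <;> exact abs_integral_le_integral_abs
    refine h1.trans ((integral_mono_measure htv (Filter.Eventually.of_forall fun _ => abs_nonneg _)
      (hCint _ hφ).abs).trans_eq ?_)
    rw [integral_smul_nnreal_measure]; rfl
  have hsadd : ∀ φ ψ : α → ℝ, Integrable φ μ → Integrable ψ μ →
      sintegral (φ + ψ) s = sintegral φ s + sintegral ψ s := by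
    intro φ ψ hφ hψ
    unfold sintegral
    simp only [Pi.add_apply]
    rw [integral_add ((hCint _ hφ).mono_measure hle1) ((hCint _ hψ).mono_measure hle1),
      integral_add ((hCint _ hφ).mono_measure hle2) ((hCint _ hψ).mono_measure hle2)]
    ring
  have hssmul : ∀ (c : ℝ) (φ : α → ℝ), sintegral (c • φ) s = c * sintegral φ s := by
    intro c φ
    unfold sintegral
    simp only [Pi.smul_apply, smul_eq_mul, integral_const_mul]
    ring
  -- main claim
  have main : ∀ φ (hφ : Integrable φ μ), g ⟨φ, hφ⟩ = sintegral φ s := by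
    -- difference functional
    let H : E →ₗ[ℝ] ℝ :=
      { toFun := fun φ => g φ - sintegral φ s
        map_add' := by
          intro x y
          rw [map_add, Submodule.coe_add, hsadd _ _ x.2 y.2]; ring
        map_smul' := by
          intro c x
          rw [map_smul, Submodule.coe_smul, hssmul]; simp; ring }
    have hH : ∀ φ : E, |H φ| ≤ 2 * C * ∫ x, |(φ : α → ℝ) x| ∂μ := by
      intro φ
      refine (abs_sub _ _).trans ?_
      have := hgabs φ
      have := hsabs φ φ.2
      linarith
    have hH0 : ∀ φ (hφ : Integrable φ μ), H ⟨φ, hφ⟩ = 0 := by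
      have hcongr : ∀ φ ψ (hφ : Integrable φ μ) (hψ : Integrable ψ μ), φ =ᵐ[μ] ψ →
          H ⟨φ, hφ⟩ = H ⟨ψ, hψ⟩ := by
        intro φ ψ hφ hψ h
        rw [← sub_eq_zero, ← map_sub, ← abs_nonpos_iff]
        refine (hH _).trans_eq ?_
        rw [integral_eq_zero_of_ae, mul_zero]
        filter_upwards [h] with x hx
        simp [hx]
      intro φ hφ
      have key := Integrable.induction (μ := μ) (fun φ : α → ℝ => ∀ h : Integrable φ μ, H ⟨φ, h⟩ = 0)
        ?_ ?_ ?_ ?_ hφ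
      · exact key hφ
      · intro c A hA _ h
        have h1 : (⟨_, h⟩ : E) = c • ⟨_, hind A hA⟩ := by
          ext x
          by_cases hx : x ∈ A <;> simp [hx]
        rw [h1, map_smul]
        have : H ⟨_, hind A hA⟩ = 0 := by
          change g ⟨_, hind A hA⟩ - sintegral _ s = 0
          rw [← hsA A hA]
          have h2 : s A = s.toJordanDecomposition.posPart.real A
              - s.toJordanDecomposition.negPart.real A := by
            conv_lhs => rw [← s.toSignedMeasure_toJordanDecomposition]
            exact Measure.toSignedMeasure_sub_apply hA
          rw [h2]
          unfold sintegral
          rw [integral_indicator_const _ hA, integral_indicator_const _ hA]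
          simp
        rw [this, smul_zero]
      · intro a b _ ha hb h1 h2 h
        have : (⟨a + b, h⟩ : E) = ⟨a, ha⟩ + ⟨b, hb⟩ := rfl
        rw [this, map_add, h1, h2, add_zero]
      · -- closedness
        rw [← isSeqClosed_iff_isClosed]
        intro x a hx hxa h
        have hx' : ∀ n, H ⟨_, L1.integrable_coeFn (x n)⟩ = 0 := fun n => hx n _
        rw [← abs_nonpos_iff]
        have hlim : Filter.Tendsto (fun n => 2 * C * ‖a - x n‖) Filter.atTop (nhds 0) := by
          have := (tendsto_iff_norm_sub_tendsto_zero.1 hxa).const_mul (2 * C : ℝ)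
          simp only [mul_zero, norm_sub_rev (x _) a] at this
          exact this
        refine ge_of_tendsto' hlim fun n => ?_
        have : H ⟨a, h⟩ = H (⟨a, h⟩ - ⟨_, L1.integrable_coeFn (x n)⟩) := by
          rw [map_sub, hx', sub_zero]
        rw [this]
        refine (hH _).trans_eq ?_
        rw [L1.norm_eq_integral_norm]
        congr 1
        refine integral_congr_ae ?_
        filter_upwards [Lp.coeFn_sub a (x n)] with z hz
        rw [hz]; rfl
      · intro a b hab ha h1 h
        rw [← hcongr _ _ ha h hab]; exact h1 ha
    intro φ hφ
    have := hH0 φ hφ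
    change g ⟨φ, hφ⟩ - sintegral φ s = 0 at this
    linarith
  refine ⟨s, fun φ => ?_, hsb⟩
  rw [← main φ (hVE φ.2)]
  exact (hg1 ⟨⟨φ, hVE φ.2⟩, φ.2⟩).symm

end SI

section Moll
set_option linter.unusedSectionVars false
open Filter Topology Metric
variable {G : Type*} [NormedAddCommGroup G] [NormedSpace ℝ G] [FiniteDimensional ℝ G]
  [MeasureSpace G] [BorelSpace G] [(volume : Measure G).IsAddHaarMeasure]

/-- The bump functions used for mollification. -/
def bmp (G : Type*) [NormedAddCommGroup G] (n : ℕ) : ContDiffBump (0 : G) :=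
  ⟨1 / (n + 1) / 2, 1 / (n + 1), by positivity, by
    have : (0 : ℝ) < 1 / (n + 1) := by positivity
    linarith⟩

lemma bmp_rOut (n : ℕ) : (bmp G n).rOut = 1 / (n + 1) := rfl

/-- The mollifier. -/
def rho (G : Type*) [NormedAddCommGroup G] [NormedSpace ℝ G] [FiniteDimensional ℝ G]
    [MeasureSpace G] (n : ℕ) : G → ℝ := (bmp G n).normed volume

/-- Mollification. -/
def mol (n : ℕ) (q : G → ℝ) : G → ℝ :=
  convolution (rho G n) q (ContinuousLinearMap.lsmul ℝ ℝ) volume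

lemma tendsto_rOut : Tendsto (fun n => (bmp G n).rOut) atTop (𝓝 0) := by
  simpa only [bmp_rOut] using tendsto_one_div_add_atTop_nhds_zero_nat (𝕜 := ℝ)

lemma rho_nonneg (n : ℕ) (z : G) : 0 ≤ rho G n z := (bmp G n).nonneg_normed z

lemma rho_contDiff (n : ℕ) : ContDiff ℝ ∞ (rho G n) := (bmp G n).contDiff_normed (n := ⊤)

lemma rho_cont (n : ℕ) : Continuous (rho G n) := (rho_contDiff n).continuous

lemma rho_compact (n : ℕ) : HasCompactSupport (rho G n) := (bmp G n).hasCompactSupport_normed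

lemma rho_neg (n : ℕ) (z : G) : rho G n (-z) = rho G n z := (bmp G n).normed_neg z

lemma rho_integral (n : ℕ) : ∫ z, rho G n z = 1 := (bmp G n).integral_normed

lemma rho_int (n : ℕ) : Integrable (rho G n) := (bmp G n).integrable_normed

lemma rho_bdd (n : ℕ) : ∃ B, ∀ z : G, |rho G n z| ≤ B := by
  obtain ⟨B, hB⟩ := (rho_compact (G := G) n).exists_bound_of_continuous (rho_cont n)
  exact ⟨B, hB⟩

lemma mol_apply (n : ℕ) (q : G → ℝ) (z : G) : mol n q z = ∫ y, rho G n (z - y) * q y := by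
  unfold mol
  rw [convolution_eq_swap]
  rfl

lemma mol_contDiff (n : ℕ) {q : G → ℝ} (hq : LocallyIntegrable q) : ContDiff ℝ ∞ (mol n q) :=
  (rho_compact n).contDiff_convolution_left (n := ⊤) _ (rho_contDiff n) hq

lemma mol_fderiv (n : ℕ) {q : G → ℝ} (hq : LocallyIntegrable q) (z v : G) :
    fderiv ℝ (mol n q) z v = ∫ y, fderiv ℝ (rho G n) (z - y) v * q y := by
  have hc : HasCompactSupport (rho G n) := rho_compact n
  have hs : ContDiff ℝ 1 (rho G n) := (rho_contDiff n).of_le (by simp)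
  have h0 : mol n q = convolution (rho G n) q (ContinuousLinearMap.lsmul ℝ ℝ) volume := rfl
  rw [h0]
  generalize rho G n = r at *
  rw [(hc.hasFDerivAt_convolution_left (ContinuousLinearMap.lsmul ℝ ℝ) hs hq z).fderiv,
    convolution_eq_swap]
  have hce := ((hc.fderiv (𝕜 := ℝ)).convolutionExists_left
      ((ContinuousLinearMap.lsmul ℝ ℝ : ℝ →L[ℝ] ℝ →L[ℝ] ℝ).precompL G)
      (hs.continuous_fderiv (by simp)) hq z).integrable_swap
  rw [ContinuousLinearMap.integral_apply hce]
  rfl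

lemma translate_tsupport (n : ℕ) (z : G) :
    tsupport (fun y => rho G n (z - y)) ⊆ closedBall z (1 / (n + 1)) := by
  refine closure_minimal ?_ isClosed_closedBall
  intro y hy
  have : z - y ∈ Function.support ((bmp G n).normed volume) := hy
  rw [ContDiffBump.support_normed_eq, mem_ball_zero_iff, bmp_rOut] at this
  rw [mem_closedBall, dist_comm, dist_eq_norm]
  exact this.le

lemma translate_contDiff (n : ℕ) (z : G) : ContDiff ℝ ∞ (fun y => rho G n (z - y)) :=
  (rho_contDiff n).comp (contDiff_const.sub contDiff_id)

lemma translate_compact (n : ℕ) (z : G) : HasCompactSupport (fun y => rho G n (z - y)) :=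
  HasCompactSupport.of_support_subset_isCompact (isCompact_closedBall z (1 / (n + 1)))
    (subset_closure.trans (translate_tsupport n z))

lemma translate_fderiv (n : ℕ) (z y v : G) :
    fderiv ℝ (fun y => rho G n (z - y)) y v = - fderiv ℝ (rho G n) (z - y) v := by
  have h1 : HasFDerivAt (fun y : G => z - y) (-ContinuousLinearMap.id ℝ G) y := by
    simpa using (hasFDerivAt_id (𝕜 := ℝ) y).const_sub z
  have h2 : HasFDerivAt (rho G n) (fderiv ℝ (rho G n) (z - y)) (z - y) :=
    ((rho_contDiff n).differentiable (by simp) (z - y)).hasFDerivAt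
  have h3 := h2.comp y h1
  have h4 : fderiv ℝ (fun y => rho G n (z - y)) y = _ := h3.fderiv
  rw [h4]; simp

/-- The derivative of a mollification in terms of a test function. -/
lemma mol_fderiv' (n : ℕ) {q : G → ℝ} (hq : LocallyIntegrable q) (z v : G) :
    ∫ y, q y * fderiv ℝ (fun y => rho G n (z - y)) y v = - fderiv ℝ (mol n q) z v := by
  rw [mol_fderiv n hq, ← integral_neg]
  congr 1; ext y
  rw [translate_fderiv]; ring

lemma mol_abs_le (n : ℕ) {q : G → ℝ} {B : ℝ} (hB : ∀ z, |q z| ≤ B) (z : G) :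
    |mol n q z| ≤ B := by
  rw [mol_apply]
  have hi : Integrable (fun y => rho G n (z - y)) := (rho_int n).comp_sub_left z
  rw [← Real.norm_eq_abs]
  refine (norm_integral_le_of_norm_le (hi.mul_const B)
    (Eventually.of_forall fun y => ?_)).trans_eq ?_
  · rw [norm_mul, Real.norm_eq_abs, abs_of_nonneg (rho_nonneg n _)]
    exact mul_le_mul_of_nonneg_left (hB y) (rho_nonneg n _)
  · rw [integral_mul_const, integral_sub_left_eq_self (rho G n) volume z, rho_integral, one_mul]

lemma mol_ae_tendsto {q : G → ℝ} (hq : LocallyIntegrable q) :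
    ∀ᵐ z : G, Tendsto (fun n => mol n q z) atTop (𝓝 (q z)) := by
  refine ContDiffBump.ae_convolution_tendsto_right_of_locallyIntegrable (K := 2) tendsto_rOut
    (Eventually.of_forall fun n => ?_) hq
  change (1 : ℝ) / (n + 1) ≤ 2 * (1 / (n + 1) / 2)
  linarith

lemma mol_tendsto_cont {q : G → ℝ} (hq : Continuous q) (z : G) :
    Tendsto (fun n => mol n q z) atTop (𝓝 (q z)) :=
  ContDiffBump.convolution_tendsto_right_of_continuous tendsto_rOut hq z

lemma mol_integrable (n : ℕ) {q : G → ℝ} (hq : Integrable q) : Integrable (mol n q) :=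
  (rho_int n).integrable_convolution _ hq

lemma mol_integral (n : ℕ) {q : G → ℝ} (hq : Integrable q) : ∫ z, mol n q z = ∫ z, q z := by
  unfold mol
  rw [integral_convolution _ (rho_int n) hq, rho_integral]
  simp

lemma mol_L1_nonneg {q : G → ℝ} (hq : Integrable q) (h0 : ∀ z, 0 ≤ q z) :
    Tendsto (fun n => ∫ z, |mol n q z - q z|) atTop (𝓝 0) := by
  have hm0 : ∀ n z, 0 ≤ mol n q z := fun n z => by
    rw [mol_apply]; exact integral_nonneg fun y => mul_nonneg (rho_nonneg n _) (h0 y)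
  have hpos : ∀ n, Integrable (fun z => max (q z - mol n q z) 0) := fun n =>
    (hq.sub (mol_integrable n hq)).pos_part
  have h1 : ∀ n, ∫ z, |mol n q z - q z| = 2 * ∫ z, max (q z - mol n q z) 0 := by
    intro n
    have : ∀ z, |mol n q z - q z| = (mol n q z - q z) + 2 * max (q z - mol n q z) 0 := by
      intro z
      rcases le_total (mol n q z) (q z) with h | h
      · rw [abs_of_nonpos (by linarith), max_eq_left (by linarith)]; ring
      · rw [abs_of_nonneg (by linarith), max_eq_right (by linarith)]; ring
    simp_rw [this]
    have i0 : Integrable (fun z => mol n q z - q z) := (mol_integrable n hq).sub hq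
    rw [integral_add i0 ((hpos n).const_mul 2),
      integral_sub (mol_integrable n hq) hq, mol_integral n hq, integral_const_mul]
    ring
  simp_rw [h1]
  have : Tendsto (fun n => ∫ z, max (q z - mol n q z) 0) atTop (𝓝 (∫ z : G, (0 : ℝ))) := by
    refine tendsto_integral_of_dominated_convergence q (fun n => (hpos n).1) hq
      (fun n => Eventually.of_forall fun z => ?_) ?_
    · rw [Real.norm_eq_abs, abs_of_nonneg (le_max_right _ _)]
      exact max_le (by linarith [hm0 n z]) (h0 z)
    · filter_upwards [mol_ae_tendsto hq.locallyIntegrable] with z hz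
      have := (hz.const_sub (q z)).max (tendsto_const_nhds (x := (0 : ℝ)))
      simpa using this
  simpa using this.const_mul 2

lemma mol_sub (n : ℕ) {q r : G → ℝ} (hq : LocallyIntegrable q) (hr : LocallyIntegrable r) (z : G) :
    mol n (fun y => q y - r y) z = mol n q z - mol n r z := by
  have : ∀ {k : G → ℝ}, LocallyIntegrable k → Integrable (fun y => rho G n (z - y) * k y) :=
    fun hk => ((rho_compact n).convolutionExists_left (ContinuousLinearMap.lsmul ℝ ℝ)
      (rho_cont n) hk z).integrable_swap
  simp only [mol_apply, mul_sub]
  exact integral_sub (this hq) (this hr)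

lemma mol_L1 {q : G → ℝ} (hq : Integrable q) :
    Tendsto (fun n => ∫ z, |mol n q z - q z|) atTop (𝓝 0) := by
  have hp := hq.pos_part
  have hn := hq.neg_part
  have h1 := (mol_L1_nonneg hp fun z => le_max_right _ _).add
    (mol_L1_nonneg hn fun z => le_max_right _ _)
  rw [add_zero] at h1
  refine squeeze_zero (fun n => integral_nonneg fun z => abs_nonneg _) (fun n => ?_) h1
  have i1 : Integrable (fun z => |mol n (fun a => max (q a) 0) z - max (q z) 0|) :=
    ((mol_integrable n hp).sub hp).abs
  have i2 : Integrable (fun z => |mol n (fun a => max (-q a) 0) z - max (-q z) 0|) :=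
    ((mol_integrable n hn).sub hn).abs
  rw [← integral_add i1 i2]
  refine integral_mono ((mol_integrable n hq).sub hq).abs (i1.add i2) fun z => ?_
  have e : q = fun y => max (q y) 0 - max (-q y) 0 := by
    ext y; rw [max_zero_sub_max_neg_zero_eq_self]
  have e2 : mol n q z = mol n (fun y => max (q y) 0) z - mol n (fun y => max (-q y) 0) z := by
    conv_lhs => rw [e]
    exact mol_sub n hp.locallyIntegrable hn.locallyIntegrable z
  change |mol n q z - q z| ≤ |mol n (fun y => max (q y) 0) z - max (q z) 0|
    + |mol n (fun y => max (-q y) 0) z - max (-q z) 0|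
  have e3 : q z = max (q z) 0 - max (-q z) 0 := by rw [max_zero_sub_max_neg_zero_eq_self]
  have : mol n q z - q z = (mol n (fun y => max (q y) 0) z - max (q z) 0)
    - (mol n (fun y => max (-q y) 0) z - max (-q z) 0) := by
    rw [e2]; linarith
  rw [this]
  exact abs_sub _ _

/-- Product of an `L¹`-convergent sequence with a bounded a.e. convergent one. -/
lemma tendsto_mol_mul {q : G → ℝ} (hq : Integrable q) {w : ℕ → G → ℝ} {w' : G → ℝ} {B : ℝ}
    (hwm : ∀ n, AEStronglyMeasurable (w n) volume) (hw : ∀ n z, |w n z| ≤ B)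
    (hlim : ∀ᵐ z : G, Tendsto (fun n => w n z) atTop (𝓝 (w' z))) :
    Tendsto (fun n => ∫ z, mol n q z * w n z) atTop (𝓝 (∫ z, q z * w' z)) := by
  have h1 : Tendsto (fun n => ∫ z, q z * w n z) atTop (𝓝 (∫ z, q z * w' z)) := by
    refine tendsto_integral_of_dominated_convergence (fun z => |q z| * B)
      (fun n => hq.1.mul (hwm n)) (hq.abs.mul_const B)
      (fun n => Eventually.of_forall fun z => ?_) ?_
    · rw [norm_mul]
      exact mul_le_mul_of_nonneg_left (hw n z) (abs_nonneg _)
    · filter_upwards [hlim] with z hz using hz.const_mul _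
  have i1 : ∀ n, Integrable (fun z => (mol n q z - q z) * w n z) := fun n =>
    ((mol_integrable n hq).sub hq).mul_bdd (c := B) (hwm n) (Eventually.of_forall (hw n))
  have i2 : ∀ n, Integrable (fun z => q z * w n z) := fun n =>
    hq.mul_bdd (c := B) (hwm n) (Eventually.of_forall (hw n))
  have h2 : Tendsto (fun n => ∫ z, (mol n q z - q z) * w n z) atTop (𝓝 0) := by
    have := (mol_L1 hq).mul_const B
    rw [zero_mul] at this
    refine squeeze_zero_norm (fun n => ?_) this
    rw [← integral_mul_const]
    refine norm_integral_le_of_norm_le ((((mol_integrable n hq).sub hq).abs).mul_const B)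
      (Eventually.of_forall fun z => ?_)
    rw [norm_mul]
    exact mul_le_mul_of_nonneg_left (hw n z) (abs_nonneg _)
  have h3 := h2.add h1
  rw [zero_add] at h3
  refine h3.congr fun n => ?_
  rw [← integral_add (i1 n) (i2 n)]
  congr 1; ext z; ring

/-- Swap lemma for a finite measure. -/
lemma tendsto_mol_measure {μ : Measure G} [IsFiniteMeasure μ] {ψ : G → ℝ} (hψ : Continuous ψ)
    (hc : HasCompactSupport ψ) :
    (∀ n, Integrable (fun z => ψ z * ∫ y, rho G n (z - y) ∂μ)) ∧
    Tendsto (fun n => ∫ z, ψ z * ∫ y, rho G n (z - y) ∂μ) atTop (𝓝 (∫ y, ψ y ∂μ)) := by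
  obtain ⟨B, hB⟩ := hc.exists_bound_of_continuous hψ
  have hψi : Integrable ψ := hψ.integrable_of_hasCompactSupport hc
  have hIntg : ∀ n, Integrable (Function.uncurry fun (z : G) (y : G) => ψ z * rho G n (z - y))
      (volume.prod μ) := by
    intro n
    obtain ⟨K, hK⟩ := rho_bdd (G := G) n
    have h1 : Integrable (fun a : G × G => ψ a.1) (volume.prod μ) := hψi.comp_fst μ
    have := h1.mul_bdd (c := K) (g := fun a : G × G => rho G n (a.1 - a.2))
      ((rho_cont n).comp (continuous_fst.sub continuous_snd)).aestronglyMeasurable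
      (Eventually.of_forall fun a => hK _)
    exact this
  refine ⟨fun n => ?_, ?_⟩
  · have := (hIntg n).integral_prod_left
    simpa only [Function.uncurry, integral_const_mul] using this
  have h1 : ∀ n, ∫ z, ψ z * ∫ y, rho G n (z - y) ∂μ = ∫ y, mol n ψ y ∂μ := by
    intro n
    simp_rw [← integral_const_mul]
    rw [integral_integral_swap (hIntg n)]
    congr 1; ext y
    rw [mol_apply]
    congr 1; ext z
    rw [mul_comm, ← rho_neg, neg_sub]
  simp_rw [h1]
  refine tendsto_integral_of_dominated_convergence (fun _ => B)
    (fun n => (mol_contDiff n hψi.locallyIntegrable).continuous.aestronglyMeasurable)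
    (integrable_const B) (fun n => Eventually.of_forall fun z => mol_abs_le n hB z)
    (Eventually.of_forall fun z => mol_tendsto_cont hψ z)

lemma integral_fderiv_zero {g : G → ℝ} (hg : ContDiff ℝ ∞ g) (hc : HasCompactSupport g) (v : G) :
    ∫ z, fderiv ℝ g z v = 0 := by
  have hd : Continuous fun z => fderiv ℝ g z v :=
    (hg.continuous_fderiv (by simp)).clm_apply continuous_const
  have hdc : HasCompactSupport fun z => fderiv ℝ g z v := hc.fderiv_apply ℝ v
  have := integral_mul_fderiv_eq_neg_fderiv_mul_of_integrable (μ := (volume : Measure G))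
    (f := fun _ => (1 : ℝ)) (g := g) (v := v) (by simp)
    (by simpa using hd.integrable_of_hasCompactSupport hdc)
    (by simpa using hg.continuous.integrable_of_hasCompactSupport hc) (by simp)
    (fun x _ => hg.differentiable (by simp) x)
  simpa using this

end Moll

section Alg

/-- Directional derivative bookkeeping. -/
def HD {G : Type*} [NormedAddCommGroup G] [NormedSpace ℝ G] (z v : G) (f : G → ℝ) (f' : ℝ) : Prop :=
  DifferentiableAt ℝ f z ∧ fderiv ℝ f z v = f'

variable {G : Type*} [NormedAddCommGroup G] [NormedSpace ℝ G] {z v : G}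

lemma HD.of {f : G → ℝ} (hf : ContDiff ℝ ∞ f) : HD z v f (fderiv ℝ f z v) :=
  ⟨hf.differentiable (by simp) z, rfl⟩

lemma HD.mul {f g : G → ℝ} {f' g' : ℝ} (hf : HD z v f f') (hg : HD z v g g') :
    HD z v (fun x => f x * g x) (f' * g z + f z * g') := by
  refine ⟨hf.1.mul hg.1, ?_⟩
  rw [fderiv_fun_mul hf.1 hg.1]
  simp [hf.2, hg.2]; ring

lemma HD.add {f g : G → ℝ} {f' g' : ℝ} (hf : HD z v f f') (hg : HD z v g g') :
    HD z v (fun x => f x + g x) (f' + g') := by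
  refine ⟨hf.1.add hg.1, ?_⟩
  rw [fderiv_fun_add hf.1 hg.1]
  simp [hf.2, hg.2]

lemma HD.sub {f g : G → ℝ} {f' g' : ℝ} (hf : HD z v f f') (hg : HD z v g g') :
    HD z v (fun x => f x - g x) (f' - g') := by
  refine ⟨hf.1.sub hg.1, ?_⟩
  rw [fderiv_fun_sub hf.1 hg.1]
  simp [hf.2, hg.2]

lemma HD.sum {ι : Type*} (s : Finset ι) {f : ι → G → ℝ} {f' : ι → ℝ}
    (hf : ∀ i, HD z v (f i) (f' i)) :
    HD z v (fun x => ∑ i ∈ s, f i x) (∑ i ∈ s, f' i) := by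
  have h : ∀ i ∈ s, DifferentiableAt ℝ (f i) z := fun i _ => (hf i).1
  refine ⟨DifferentiableAt.fun_sum h, ?_⟩
  rw [fderiv_fun_sum h]
  simp [(hf _).2]

lemma HD.half_sq {ι : Type*} (s : Finset ι) {f : ι → G → ℝ} {f' : ι → ℝ}
    (hf : ∀ i, HD z v (f i) (f' i)) :
    HD z v (fun x => (∑ i ∈ s, f i x ^ 2) / 2) (∑ i ∈ s, f i z * f' i) := by
  have h := (HD.sum s fun i => (hf i).mul (hf i))
  have h2 : HD z v (fun _ => (1 / 2 : ℝ)) 0 := ⟨by simp, by simp⟩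
  have h3 := h.mul h2
  convert h3 using 1
  · ext x
    simp only [pow_two]; ring
  · rw [mul_zero, add_zero, Finset.sum_mul]
    refine Finset.sum_congr rfl fun i _ => ?_
    ring

lemma alg_id {ι : Type*} [Fintype ι] (a at' : ι → ℝ) (da q dq : ι → ι → ℝ) (p : ℝ) (dp F : ι → ℝ)
    (ψ ψt : ℝ) (dψ : ι → ℝ) (Em : ι → ι → ℝ)
    (H1 : ∀ k, at' k + ∑ i, dq i k + dp k = F k) (H2 : ∑ i, da i i = 0)
    (H3 : ∀ i j, Em i j = (1 / 2) * (da j i + da i j)) (hq : ∀ i j, q i j = q j i) :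
    (ψt * ((∑ k, a k ^ 2) / 2) + ψ * ∑ k, a k * at' k) +
      ∑ i, (dψ i * (((∑ k, a k ^ 2) / 2 + p) * a i - ∑ j, (a i * a j - q i j) * a j)
        + ψ * (((∑ k, a k * da i k + dp i) * a i + ((∑ k, a k ^ 2) / 2 + p) * da i i)
          - ∑ j, ((da i i * a j + a i * da i j - dq i j) * a j + (a i * a j - q i j) * da i j)))
    = ((∑ k, a k ^ 2) / 2 * ψt
        + ∑ i, ((∑ k, a k ^ 2) / 2 * a i - ∑ j, (a i * a j - q i j) * a j) * dψ i)
        + p * (∑ i, a i * dψ i) + ∑ k, F k * (a k * ψ)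
      - ψ * ∑ i, ∑ j, (a i * a j - q i j) * Em i j := by
  set S := (∑ k, a k ^ 2) / 2 with hS
  have e1 : ∑ i, ∑ j, (a i * a j - q i j) * Em i j = ∑ i, ∑ j, (a i * a j - q i j) * da i j := by
    have h1 : ∑ i, ∑ j, (a i * a j - q i j) * da j i = ∑ i, ∑ j, (a i * a j - q i j) * da i j := by
      rw [Finset.sum_comm]
      refine Finset.sum_congr rfl fun i _ => Finset.sum_congr rfl fun j _ => ?_
      rw [hq j i, mul_comm (a j)]
    have h2 : ∑ i, ∑ j, (a i * a j - q i j) * Em i j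
        = (1 / 2) * (∑ i, ∑ j, (a i * a j - q i j) * da j i)
          + (1 / 2) * ∑ i, ∑ j, (a i * a j - q i j) * da i j := by
      simp only [Finset.mul_sum, ← Finset.sum_add_distrib]
      refine Finset.sum_congr rfl fun i _ => Finset.sum_congr rfl fun j _ => ?_
      rw [H3]; ring
    rw [h2, h1]; ring
  have e2 : ∑ k, F k * (a k * ψ) = ψ * (∑ k, a k * at' k) + ψ * (∑ i, ∑ j, dq i j * a j)
      + ψ * ∑ k, dp k * a k := by
    rw [Finset.sum_comm (f := fun i j => dq i j * a j)]
    simp only [Finset.mul_sum, ← Finset.sum_add_distrib]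
    refine Finset.sum_congr rfl fun k _ => ?_
    rw [← H1 k]
    simp only [← Finset.mul_sum, ← Finset.sum_mul]
    ring
  have e3 : ∑ i, (((∑ k, a k * da i k + dp i) * a i + (S + p) * da i i)
          - ∑ j, ((da i i * a j + a i * da i j - dq i j) * a j + (a i * a j - q i j) * da i j))
      = ∑ k, dp k * a k + ∑ i, ∑ j, dq i j * a j - ∑ i, ∑ j, (a i * a j - q i j) * da i j := by
    have : ∀ i, (((∑ k, a k * da i k + dp i) * a i + (S + p) * da i i)
          - ∑ j, ((da i i * a j + a i * da i j - dq i j) * a j + (a i * a j - q i j) * da i j))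
        = dp i * a i + ∑ j, dq i j * a j - ∑ j, (a i * a j - q i j) * da i j
          + (S + p - ∑ j, a j * a j) * da i i := by
      intro i
      have h : ∑ j, ((da i i * a j + a i * da i j - dq i j) * a j + (a i * a j - q i j) * da i j)
        = da i i * (∑ j, a j * a j) + a i * (∑ j, a j * da i j) - (∑ j, dq i j * a j)
          + ∑ j, (a i * a j - q i j) * da i j := by
        simp only [Finset.mul_sum, ← Finset.sum_add_distrib, ← Finset.sum_sub_distrib]
        refine Finset.sum_congr rfl fun j _ => ?_
        ring
      rw [h]; ring
    simp only [this]
    rw [Finset.sum_add_distrib, Finset.sum_sub_distrib, Finset.sum_add_distrib, ← Finset.mul_sum,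
      H2]
    ring
  have e4 : ∑ i, dψ i * ((S + p) * a i - ∑ j, (a i * a j - q i j) * a j)
      = ∑ i, (S * a i - ∑ j, (a i * a j - q i j) * a j) * dψ i + p * (∑ i, a i * dψ i) := by
    rw [Finset.mul_sum (a := p), ← Finset.sum_add_distrib]
    refine Finset.sum_congr rfl fun j _ => ?_
    ring
  rw [Finset.sum_add_distrib, ← Finset.mul_sum, e3, e4, e1, e2]
  ring

end Alg

section Conv
open Filter Topology Metric

lemma tendsto_bdd_sum {X ι : Type*} [Fintype ι] [MeasurableSpace X] {μ : Measure X}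
    {b : ℕ → ι → X → ℝ} {b' χ : ι → X → ℝ} {B : ℝ}
    (hb : ∀ n i, AEStronglyMeasurable (b n i) μ) (hB : ∀ n i z, |b n i z| ≤ B)
    (hχ : ∀ i, Integrable (χ i) μ)
    (hlim : ∀ i, ∀ᵐ z ∂μ, Tendsto (fun n => b n i z) atTop (𝓝 (b' i z))) :
    Tendsto (fun n => ∫ z, ∑ i, b n i z * χ i z ∂μ) atTop (𝓝 (∫ z, ∑ i, b' i z * χ i z ∂μ)) := by
  refine tendsto_integral_of_dominated_convergence (fun z => ∑ i, B * |χ i z|) (fun n => ?_)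
    (integrable_finsetSum _ fun i _ => (hχ i).abs.const_mul B)
    (fun n => Eventually.of_forall fun z => ?_) ?_
  · exact Finset.aestronglyMeasurable_fun_sum _ fun i _ => (hb n i).mul (hχ i).1
  · refine (norm_sum_le _ _).trans (Finset.sum_le_sum fun i _ => ?_)
    rw [norm_mul]
    exact mul_le_mul_of_nonneg_right (hB n i z) (abs_nonneg _)
  · filter_upwards [ae_all_iff.2 hlim] with z hz
    exact tendsto_finsetSum _ fun i _ => (hz i).mul_const _

end Conv

section Euler
open Filter Topology Metric

/-- Space-time. -/
abbrev SpT (d : ℕ) := EuclideanSpace ℝ (Fin d) × ℝ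

instance instHaarSpT : (volume : Measure (SpT d)).IsAddHaarMeasure :=
  inferInstanceAs ((volume.prod volume : Measure (SpT d)).IsAddHaarMeasure)

lemma integral_add3 {X : Type*} [MeasurableSpace X] {μ : Measure X} {f1 f2 f3 : X → ℝ}
    (h1 : Integrable f1 μ) (h2 : Integrable f2 μ) (h3 : Integrable f3 μ) :
    ∫ z, (f1 z + f2 z + f3 z) ∂μ = ∫ z, f1 z ∂μ + ∫ z, f2 z ∂μ + ∫ z, f3 z ∂μ := by
  have h12 : Integrable (fun z => f1 z + f2 z) μ := h1.add h2
  rw [integral_add h12 h3, integral_add h1 h2]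

lemma integral_add4 {X : Type*} [MeasurableSpace X] {μ : Measure X} {f1 f2 f3 f4 : X → ℝ}
    (h1 : Integrable f1 μ) (h2 : Integrable f2 μ) (h3 : Integrable f3 μ) (h4 : Integrable f4 μ) :
    ∫ z, (f1 z + f2 z + f3 z + f4 z) ∂μ
      = ∫ z, f1 z ∂μ + ∫ z, f2 z ∂μ + ∫ z, f3 z ∂μ + ∫ z, f4 z ∂μ := by
  have h12 : Integrable (fun z => f1 z + f2 z + f3 z) μ := (h1.add h2).add h3
  rw [integral_add h12 h4, integral_add3 h1 h2 h3]

/-- Spatial unit vector in space-time. -/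
def ev (i : Fin d) : SpT d := (EuclideanSpace.single i 1, 0)

/-- Time unit vector in space-time. -/
def tv : SpT d := (0, 1)

lemma isTest_translate {Ω : Set (EuclideanSpace ℝ (Fin d))} {T : ℝ} {n : ℕ} {z : SpT d}
    (h : closedBall z (1 / ((n : ℝ) + 1)) ⊆ Ω ×ˢ Set.Ioo 0 T) :
    IsTest Ω T (fun y => rho (SpT d) n (z - y)) :=
  ⟨translate_contDiff n z, translate_compact n z, (translate_tsupport n z).trans h⟩

lemma int_mul_test {q φ : SpT d → ℝ} (hq : LocallyIntegrable q) (hφ : Continuous φ)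
    (hc : HasCompactSupport φ) : Integrable (fun z => q z * φ z) := by
  have := hq.integrable_smul_right_of_hasCompactSupport hφ hc
  simpa using this

lemma int_mul_fderiv {q φ : SpT d → ℝ} (hq : LocallyIntegrable q) (hφ : ContDiff ℝ ∞ φ)
    (hc : HasCompactSupport φ) (v : SpT d) : Integrable (fun z => q z * fderiv ℝ φ z v) :=
  int_mul_test hq ((hφ.continuous_fderiv (by simp)).clm_apply continuous_const)
    (hc.fderiv_apply ℝ v)

lemma fderiv_zero_of_notMem {φ : SpT d → ℝ} {z : SpT d} (hz : z ∉ tsupport φ) : fderiv ℝ φ z = 0 := by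
  by_contra h
  exact hz (support_fderiv_subset ℝ h)

/-- Mollified energy identity. -/
lemma energy_id {Ω : Set (EuclideanSpace ℝ (Fin d))} {T : ℝ}
    {u : Fin d → SpT d → ℝ} {P : SpT d → ℝ} {F : Fin d → SpT d → ℝ}
    (hu : ∀ i, LocallyIntegrable (u i)) (huu : ∀ i j, LocallyIntegrable (fun z => u i z * u j z))
    (hP : LocallyIntegrable P) (hF : ∀ i, LocallyIntegrable (F i))
    (hmom : ∀ ψ, IsTest Ω T ψ → ∀ k,
      ∫ z, (u k z * fderiv ℝ ψ z tv + ∑ i, (u i z * u k z) * fderiv ℝ ψ z (ev i)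
        + P z * fderiv ℝ ψ z (ev k) + F k z * ψ z) = 0)
    (hdiv : ∀ ψ, IsTest Ω T ψ → ∫ z, ∑ i, u i z * fderiv ℝ ψ z (ev i) = 0)
    {Eu : Fin d → Fin d → SignedMeasure (SpT d)}
    (hEu : ∀ i j, ∀ ψ, IsTest Ω T ψ → sintegral ψ (Eu i j) =
      -(1 / 2) * ∫ z, (u i z * fderiv ℝ ψ z (ev j) + u j z * fderiv ℝ ψ z (ev i)))
    {ψ : SpT d → ℝ} (hψ : IsTest Ω T ψ) (n : ℕ)
    (hn : ∀ z ∈ tsupport ψ, closedBall z (1 / ((n : ℝ) + 1)) ⊆ Ω ×ˢ Set.Ioo 0 T) :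
    ∫ z, (((∑ k, mol n (u k) z ^ 2) / 2 * fderiv ℝ ψ z tv
        + ∑ i, ((∑ k, mol n (u k) z ^ 2) / 2 * mol n (u i) z
          - ∑ j, (mol n (u i) z * mol n (u j) z - mol n (fun y => u i y * u j y) z)
            * mol n (u j) z) * fderiv ℝ ψ z (ev i))
        + mol n P z * (∑ i, mol n (u i) z * fderiv ℝ ψ z (ev i))
        + ∑ k, mol n (F k) z * (mol n (u k) z * ψ z))
    = ∫ z, ψ z * ∑ i, ∑ j, (mol n (u i) z * mol n (u j) z - mol n (fun y => u i y * u j y) z)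
        * sintegral (fun y => rho (SpT d) n (z - y)) (Eu i j) := by
  obtain ⟨hψs, hψc, hψU⟩ := hψ
  have hA : ∀ i, ContDiff ℝ ∞ (mol n (u i)) := fun i => mol_contDiff n (hu i)
  have hQ : ∀ i j, ContDiff ℝ ∞ (mol n (fun y => u i y * u j y)) := fun i j => mol_contDiff n (huu i j)
  have hPs : ContDiff ℝ ∞ (mol n P) := mol_contDiff n hP
  have hFs : ∀ i, ContDiff ℝ ∞ (mol n (F i)) := fun i => mol_contDiff n (hF i)
  have hAc := fun i => (hA i).continuous
  have hQc := fun i j => (hQ i j).continuous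
  have hPc := hPs.continuous
  have hFc := fun i => (hFs i).continuous
  have hψcont := hψs.continuous
  have hdψ : ∀ v, Continuous (fun z => fderiv ℝ ψ z v) := fun v =>
    (hψs.continuous_fderiv (by simp)).clm_apply continuous_const
  set f1 : SpT d → ℝ := fun z => ((∑ k, mol n (u k) z ^ 2) / 2 * fderiv ℝ ψ z tv
        + ∑ i, ((∑ k, mol n (u k) z ^ 2) / 2 * mol n (u i) z
          - ∑ j, (mol n (u i) z * mol n (u j) z - mol n (fun y => u i y * u j y) z)
            * mol n (u j) z) * fderiv ℝ ψ z (ev i))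
        + mol n P z * (∑ i, mol n (u i) z * fderiv ℝ ψ z (ev i))
        + ∑ k, mol n (F k) z * (mol n (u k) z * ψ z) with hf1
  set f2 : SpT d → ℝ := fun z => ψ z * ∑ i, ∑ j, (mol n (u i) z * mol n (u j) z
      - mol n (fun y => u i y * u j y) z) * sintegral (fun y => rho (SpT d) n (z - y)) (Eu i j) with hf2
  let Gt : SpT d → ℝ := fun z => ψ z * ((∑ k, mol n (u k) z ^ 2) / 2)
  let Gx : Fin d → SpT d → ℝ := fun i z => ψ z * (((∑ k, mol n (u k) z ^ 2) / 2 + mol n P z)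
    * mol n (u i) z - ∑ j, (mol n (u i) z * mol n (u j) z - mol n (fun y => u i y * u j y) z)
            * mol n (u j) z)
  have hGt : ContDiff ℝ ∞ Gt := by
    have := hA
    fun_prop
  have hGx : ∀ i, ContDiff ℝ ∞ (Gx i) := by
    intro i
    have := hA
    have := hQ
    fun_prop
  have hGtc : HasCompactSupport Gt := hψc.mul_right
  have hGxc : ∀ i, HasCompactSupport (Gx i) := fun i => hψc.mul_right
  have hf1c : Continuous f1 := by fun_prop
  have hf1s : HasCompactSupport f1 := by
    refine HasCompactSupport.intro hψc fun z hz => ?_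
    simp [hf1, fderiv_zero_of_notMem hz, image_eq_zero_of_notMem_tsupport hz]
  have hpt : ∀ z, f2 z = f1 z - (fderiv ℝ Gt z tv + ∑ i, fderiv ℝ (Gx i) z (ev i)) := by
    intro z
    by_cases hz : z ∈ tsupport ψ
    · have htest := isTest_translate (hn z hz)
      have H1 : ∀ k, fderiv ℝ (mol n (u k)) z tv
          + ∑ i, fderiv ℝ (mol n (fun y => u i y * u k y)) z (ev i)
          + fderiv ℝ (mol n P) z (ev k) = mol n (F k) z := by
        intro k
        have h := hmom _ htest k
        have i1 := int_mul_fderiv (hu k) htest.1 htest.2.1 tv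
        have i2 := fun i => int_mul_fderiv (huu i k) htest.1 htest.2.1 (ev i)
        have i3 := int_mul_fderiv hP htest.1 htest.2.1 (ev k)
        have i4 := int_mul_test (hF k) htest.1.continuous htest.2.1
        have i2' := integrable_finsetSum Finset.univ fun i _ => i2 i
        have e4 : ∫ y, F k y * rho (SpT d) n (z - y) = mol n (F k) z := by
          rw [mol_apply]; congr 1; ext y; ring
        rw [integral_add4 i1 i2' i3 i4, integral_finsetSum _ fun i _ => i2 i, mol_fderiv' n (hu k),
          mol_fderiv' n hP, e4] at h
        simp only [mol_fderiv' n (huu _ _)] at h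
        rw [Finset.sum_neg_distrib] at h
        linarith
      have H2 : ∑ i, fderiv ℝ (mol n (u i)) z (ev i) = 0 := by
        have h := hdiv _ htest
        rw [integral_finsetSum _ fun i _ => int_mul_fderiv (hu i) htest.1 htest.2.1 (ev i)] at h
        simp only [mol_fderiv' n (hu _)] at h
        rw [Finset.sum_neg_distrib] at h
        linarith
      have H3 : ∀ i j, sintegral (fun y => rho (SpT d) n (z - y)) (Eu i j)
          = (1 / 2) * (fderiv ℝ (mol n (u i)) z (ev j) + fderiv ℝ (mol n (u j)) z (ev i)) := by
        intro i j
        rw [hEu i j _ htest, integral_add (int_mul_fderiv (hu i) htest.1 htest.2.1 (ev j))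
          (int_mul_fderiv (hu j) htest.1 htest.2.1 (ev i)), mol_fderiv' n (hu i),
          mol_fderiv' n (hu j)]
        ring
      have K := alg_id (fun k => mol n (u k) z) (fun k => fderiv ℝ (mol n (u k)) z tv)
        (fun i j => fderiv ℝ (mol n (u j)) z (ev i)) (fun i j => mol n (fun y => u i y * u j y) z)
        (fun i j => fderiv ℝ (mol n (fun y => u i y * u j y)) z (ev i)) (mol n P z)
        (fun i => fderiv ℝ (mol n P) z (ev i)) (fun k => mol n (F k) z) (ψ z) (fderiv ℝ ψ z tv)
        (fun i => fderiv ℝ ψ z (ev i)) (fun i j => sintegral (fun y => rho (SpT d) n (z - y)) (Eu i j))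
        H1 H2 H3 (fun i j => by simp only [mul_comm (u i _)])
      have D1 : fderiv ℝ Gt z tv = _ :=
        ((HD.of hψs).mul (HD.half_sq Finset.univ fun k => HD.of (hA k))).2
      have D2 : ∀ i, fderiv ℝ (Gx i) z (ev i) = _ := fun i =>
        ((HD.of hψs).mul ((((HD.half_sq Finset.univ fun k => HD.of (hA k)).add (HD.of hPs)).mul
          (HD.of (hA i))).sub (HD.sum Finset.univ fun j =>
            (((HD.of (hA i)).mul (HD.of (hA j))).sub (HD.of (hQ i j))).mul (HD.of (hA j))))).2
      rw [D1]
      simp only [D2]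
      rw [K]
      simp only [hf1, hf2]
      ring
    · have h1 : fderiv ℝ Gt z = 0 := fderiv_zero_of_notMem fun h =>
        hz (tsupport_mul_subset_left h)
      have h2 : ∀ i, fderiv ℝ (Gx i) z = 0 := fun i => fderiv_zero_of_notMem fun h =>
        hz (tsupport_mul_subset_left h)
      simp [hf1, hf2, h1, h2, fderiv_zero_of_notMem hz, image_eq_zero_of_notMem_tsupport hz]
  have hi1 : Integrable f1 := hf1c.integrable_of_hasCompactSupport hf1s
  have hIntg : ∀ {g : SpT d → ℝ} (v : SpT d), ContDiff ℝ ∞ g → HasCompactSupport g →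
      Integrable (fun z => fderiv ℝ g z v) := fun v hg hc =>
    ((hg.continuous_fderiv (by simp)).clm_apply continuous_const).integrable_of_hasCompactSupport
      (hc.fderiv_apply ℝ v)
  have hi2 := hIntg tv hGt hGtc
  have hi3 := fun i => hIntg (ev i) (hGx i) (hGxc i)
  have hi3' := integrable_finsetSum Finset.univ fun i _ => hi3 i
  have hi4 : Integrable (fun z => fderiv ℝ Gt z tv + ∑ i, fderiv ℝ (Gx i) z (ev i)) :=
    hi2.add hi3'
  rw [integral_congr_ae (Eventually.of_forall hpt), integral_sub hi1 hi4,
    integral_add hi2 hi3', integral_finsetSum _ fun i _ => hi3 i,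
    integral_fderiv_zero hGt hGtc]
  simp only [integral_fderiv_zero (hGx _) (hGxc _)]
  simp

end Euler

section Key
open Metric Filter Topology

lemma lhs_tendsto {u : Fin d → SpT d → ℝ} {P : SpT d → ℝ} {F : Fin d → SpT d → ℝ} {M : ℝ}
    (hum : ∀ i, Measurable (u i)) (hM : ∀ i z, |u i z| ≤ M)
    (hu : ∀ i, LocallyIntegrable (u i)) (huu : ∀ i j, LocallyIntegrable (fun z => u i z * u j z))
    (hP : Integrable P) (hF : ∀ i, Integrable (F i)) (hM0 : 0 ≤ M)
    {ψ : SpT d → ℝ} (hψs : ContDiff ℝ ∞ ψ) (hψc : HasCompactSupport ψ) :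
    Tendsto (fun n => ∫ z, (((∑ k, mol n (u k) z ^ 2) / 2 * fderiv ℝ ψ z tv
        + ∑ i, ((∑ k, mol n (u k) z ^ 2) / 2 * mol n (u i) z
          - ∑ j, (mol n (u i) z * mol n (u j) z - mol n (fun y => u i y * u j y) z)
            * mol n (u j) z) * fderiv ℝ ψ z (ev i))
        + mol n P z * (∑ i, mol n (u i) z * fderiv ℝ ψ z (ev i))
        + ∑ k, mol n (F k) z * (mol n (u k) z * ψ z))) atTop
     (𝓝 (∫ z, (((∑ k, u k z ^ 2) / 2 * fderiv ℝ ψ z tv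
        + ∑ i, ((∑ k, u k z ^ 2) / 2 * u i z) * fderiv ℝ ψ z (ev i))
        + P z * (∑ i, u i z * fderiv ℝ ψ z (ev i))
        + ∑ k, F k z * (u k z * ψ z)))) := by
  have hAc : ∀ n i, Continuous (mol n (u i)) := fun n i => (mol_contDiff n (hu i)).continuous
  have hQc : ∀ n i j, Continuous (mol n (fun y => u i y * u j y)) :=
    fun n i j => (mol_contDiff n (huu i j)).continuous
  have hPc : ∀ n, Continuous (mol n P) := fun n => (mol_contDiff n hP.locallyIntegrable).continuous
  have hFc : ∀ n k, Continuous (mol n (F k)) :=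
    fun n k => (mol_contDiff n (hF k).locallyIntegrable).continuous
  have hψcont := hψs.continuous
  have hdψ : ∀ v, Continuous (fun z => fderiv ℝ ψ z v) := fun v =>
    (hψs.continuous_fderiv (by simp)).clm_apply continuous_const
  have hdψc : ∀ v, HasCompactSupport (fun z => fderiv ℝ ψ z v) := fun v =>
    HasCompactSupport.intro hψc fun z hz => by simp [fderiv_zero_of_notMem hz]
  have hdi : ∀ v, Integrable (fun z => fderiv ℝ ψ z v) := fun v =>
    (hdψ v).integrable_of_hasCompactSupport (hdψc v)
  have hψi : Integrable ψ := hψcont.integrable_of_hasCompactSupport hψc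
  have hA : ∀ n i z, |mol n (u i) z| ≤ M := fun n i z => mol_abs_le n (hM i) z
  have hQ : ∀ n i j z, |mol n (fun y => u i y * u j y) z| ≤ M ^ 2 := fun n i j z =>
    mol_abs_le n (fun z => by
      rw [abs_mul, pow_two]; exact mul_le_mul (hM i z) (hM j z) (abs_nonneg _) hM0) z
  have hS : ∀ {a : Fin d → ℝ}, (∀ k, |a k| ≤ M) → |(∑ k, a k ^ 2) / 2| ≤ d * M ^ 2 := by
    intro a ha
    have h1 : ∑ k, a k ^ 2 ≤ ∑ _k : Fin d, M ^ 2 := Finset.sum_le_sum fun k _ => by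
      rw [← sq_abs]; exact pow_le_pow_left₀ (abs_nonneg _) (ha k) 2
    have h0 : 0 ≤ ∑ k, a k ^ 2 := Finset.sum_nonneg fun k _ => sq_nonneg _
    simp at h1
    rw [abs_of_nonneg (by positivity)]
    linarith
  have hall : ∀ᵐ z : SpT d, (∀ i, Tendsto (fun n => mol n (u i) z) atTop (𝓝 (u i z))) ∧
      (∀ i j, Tendsto (fun n => mol n (fun y => u i y * u j y) z) atTop (𝓝 (u i z * u j z))) := by
    have h1 : ∀ᵐ z : SpT d, ∀ i, Tendsto (fun n => mol n (u i) z) atTop (𝓝 (u i z)) :=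
      ae_all_iff.2 fun i => mol_ae_tendsto (hu i)
    have h2 : ∀ᵐ z : SpT d, ∀ i j,
        Tendsto (fun n => mol n (fun y => u i y * u j y) z) atTop (𝓝 (u i z * u j z)) :=
      ae_all_iff.2 fun i => ae_all_iff.2 fun j => mol_ae_tendsto (huu i j)
    exact h1.and h2
  have hSl : ∀ {z : SpT d}, (∀ i, Tendsto (fun n => mol n (u i) z) atTop (𝓝 (u i z))) →
      Tendsto (fun n => (∑ k, mol n (u k) z ^ 2) / 2) atTop (𝓝 ((∑ k, u k z ^ 2) / 2)) := by
    intro z h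
    exact (tendsto_finsetSum _ fun k _ => (h k).pow 2).div_const 2
  -- pieces
  have t1 : Tendsto (fun n => ∫ z, (∑ k, mol n (u k) z ^ 2) / 2 * fderiv ℝ ψ z tv) atTop
      (𝓝 (∫ z, (∑ k, u k z ^ 2) / 2 * fderiv ℝ ψ z tv)) := by
    have := tendsto_bdd_sum (μ := (volume : Measure (SpT d))) (ι := Unit)
      (b := fun n _ z => (∑ k, mol n (u k) z ^ 2) / 2)
      (b' := fun _ z => (∑ k, u k z ^ 2) / 2) (χ := fun _ z => fderiv ℝ ψ z tv) (B := d * M ^ 2)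
      (fun n _ => by
        have : Continuous (fun z => (∑ k, mol n (u k) z ^ 2) / 2) := by fun_prop
        exact this.aestronglyMeasurable)
      (fun n _ z => hS fun k => hA n k z) (fun _ => hdi tv)
      (fun _ => by filter_upwards [hall] with z hz using hSl hz.1)
    simpa using this
  have t2 : Tendsto (fun n => ∫ z, ∑ i, ((∑ k, mol n (u k) z ^ 2) / 2 * mol n (u i) z
          - ∑ j, (mol n (u i) z * mol n (u j) z - mol n (fun y => u i y * u j y) z)
            * mol n (u j) z) * fderiv ℝ ψ z (ev i)) atTop
      (𝓝 (∫ z, ∑ i, ((∑ k, u k z ^ 2) / 2 * u i z) * fderiv ℝ ψ z (ev i))) := by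
    refine tendsto_bdd_sum (μ := (volume : Measure (SpT d)))
      (b := fun n i z => (∑ k, mol n (u k) z ^ 2) / 2 * mol n (u i) z
          - ∑ j, (mol n (u i) z * mol n (u j) z - mol n (fun y => u i y * u j y) z)
            * mol n (u j) z)
      (b' := fun i z => (∑ k, u k z ^ 2) / 2 * u i z) (χ := fun i z => fderiv ℝ ψ z (ev i))
      (B := d * M ^ 2 * M + d * ((M * M + M ^ 2) * M)) ?_ ?_ (fun i => hdi (ev i)) ?_
    · intro n i
      have : Continuous (fun z => (∑ k, mol n (u k) z ^ 2) / 2 * mol n (u i) z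
          - ∑ j, (mol n (u i) z * mol n (u j) z - mol n (fun y => u i y * u j y) z)
            * mol n (u j) z) := by fun_prop
      exact this.aestronglyMeasurable
    · intro n i z
      refine (abs_sub _ _).trans (add_le_add ?_ ?_)
      · rw [abs_mul]
        exact mul_le_mul (hS fun k => hA n k z) (hA n i z) (abs_nonneg _) (by positivity)
      · refine (Finset.abs_sum_le_sum_abs _ _).trans ?_
        have : ∀ j ∈ Finset.univ, |(mol n (u i) z * mol n (u j) z - mol n (fun y => u i y * u j y) z)
            * mol n (u j) z| ≤ (M * M + M ^ 2) * M := by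
          intro j _
          rw [abs_mul]
          refine mul_le_mul ((abs_sub _ _).trans (add_le_add ?_ (hQ n i j z))) (hA n j z)
            (abs_nonneg _) (by positivity)
          rw [abs_mul]
          exact mul_le_mul (hA n i z) (hA n j z) (abs_nonneg _) hM0
        refine (Finset.sum_le_sum this).trans ?_
        simp
    · intro i
      filter_upwards [hall] with z hz
      have h2 : Tendsto (fun n => ∑ j, (mol n (u i) z * mol n (u j) z
          - mol n (fun y => u i y * u j y) z) * mol n (u j) z) atTop
          (𝓝 (∑ j, (u i z * u j z - u i z * u j z) * u j z)) :=
        tendsto_finsetSum _ fun j _ => (((hz.1 i).mul (hz.1 j)).sub (hz.2 i j)).mul (hz.1 j)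
      have := ((hSl hz.1).mul (hz.1 i)).sub h2
      simpa using this
  obtain ⟨B0, hB0⟩ := hψc.exists_bound_of_continuous hψcont
  have hBd : ∀ v, ∃ B, ∀ z, ‖fderiv ℝ ψ z v‖ ≤ B := fun v =>
    (hdψc v).exists_bound_of_continuous (hdψ v)
  choose Bd hBd using hBd
  have t3 : Tendsto (fun n => ∫ z, mol n P z * (∑ i, mol n (u i) z * fderiv ℝ ψ z (ev i))) atTop
      (𝓝 (∫ z, P z * (∑ i, u i z * fderiv ℝ ψ z (ev i)))) := by
    refine tendsto_mol_mul hP (w := fun n z => ∑ i, mol n (u i) z * fderiv ℝ ψ z (ev i))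
      (B := ∑ i, M * Bd (ev i)) ?_ ?_ ?_
    · intro n
      have : Continuous (fun z => ∑ i, mol n (u i) z * fderiv ℝ ψ z (ev i)) := by fun_prop
      exact this.aestronglyMeasurable
    · intro n z
      refine (Finset.abs_sum_le_sum_abs _ _).trans (Finset.sum_le_sum fun i _ => ?_)
      rw [abs_mul]
      exact mul_le_mul (hA n i z) (hBd _ z) (abs_nonneg _) hM0
    · filter_upwards [hall] with z hz
      exact tendsto_finsetSum _ fun i _ => (hz.1 i).mul_const _
  have t4' : ∀ k, Tendsto (fun n => ∫ z, mol n (F k) z * (mol n (u k) z * ψ z)) atTop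
      (𝓝 (∫ z, F k z * (u k z * ψ z))) := by
    intro k
    refine tendsto_mol_mul (hF k) (w := fun n z => mol n (u k) z * ψ z) (B := M * B0) ?_ ?_ ?_
    · intro n
      have : Continuous (fun z => mol n (u k) z * ψ z) := by fun_prop
      exact this.aestronglyMeasurable
    · intro n z
      rw [abs_mul]
      exact mul_le_mul (hA n k z) (hB0 z) (abs_nonneg _) hM0
    · filter_upwards [hall] with z hz
      exact (hz.1 k).mul_const _
  have b4 : ∀ k, Integrable (fun z => F k z * (u k z * ψ z)) := by
    intro k
    refine (hF k).mul_bdd (c := M * B0)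
      ((hum k).aestronglyMeasurable.mul hψcont.aestronglyMeasurable) (Eventually.of_forall fun z => ?_)
    rw [norm_mul]
    exact mul_le_mul (hM k z) (hB0 z) (norm_nonneg _) hM0
  have c4 : ∀ n k, Integrable (fun z => mol n (F k) z * (mol n (u k) z * ψ z)) := by
    intro n k
    have := int_mul_test ((hFc n k).mul (hAc n k)).locallyIntegrable hψcont hψc
    refine this.congr (Eventually.of_forall fun z => ?_)
    simp; ring
  have t4 : Tendsto (fun n => ∫ z, ∑ k, mol n (F k) z * (mol n (u k) z * ψ z)) atTop
      (𝓝 (∫ z, ∑ k, F k z * (u k z * ψ z))) := by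
    rw [integral_finsetSum _ fun k _ => b4 k]
    simp_rw [fun n => integral_finsetSum Finset.univ fun k _ => c4 n k]
    exact tendsto_finsetSum _ fun k _ => t4' k
  have c1 : ∀ n, Integrable (fun z => (∑ k, mol n (u k) z ^ 2) / 2 * fderiv ℝ ψ z tv) := fun n =>
    int_mul_fderiv (Continuous.locallyIntegrable (by fun_prop)) hψs hψc tv
  have c2 : ∀ n, Integrable (fun z => ∑ i, ((∑ k, mol n (u k) z ^ 2) / 2 * mol n (u i) z
          - ∑ j, (mol n (u i) z * mol n (u j) z - mol n (fun y => u i y * u j y) z)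
            * mol n (u j) z) * fderiv ℝ ψ z (ev i)) := fun n =>
    integrable_finsetSum _ fun i _ =>
      int_mul_fderiv (Continuous.locallyIntegrable (by fun_prop)) hψs hψc _
  have c3 : ∀ n, Integrable (fun z => mol n P z * (∑ i, mol n (u i) z * fderiv ℝ ψ z (ev i))) := by
    intro n
    simp_rw [Finset.mul_sum, ← mul_assoc]
    exact integrable_finsetSum _ fun i _ =>
      int_mul_fderiv (Continuous.locallyIntegrable (by fun_prop)) hψs hψc _
  have hSm : Measurable (fun z => (∑ k, u k z ^ 2) / 2) := by fun_prop
  have b1 : Integrable (fun z => (∑ k, u k z ^ 2) / 2 * fderiv ℝ ψ z tv) :=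
    (hdi tv).bdd_mul (c := d * M ^ 2) hSm.aestronglyMeasurable
      (Eventually.of_forall fun z => hS fun k => hM k z)
  have b2 : Integrable (fun z => ∑ i, ((∑ k, u k z ^ 2) / 2 * u i z) * fderiv ℝ ψ z (ev i)) :=
    integrable_finsetSum _ fun i _ =>
      (hdi (ev i)).bdd_mul (c := d * M ^ 2 * M) (hSm.mul (hum i)).aestronglyMeasurable
      (Eventually.of_forall fun z => by
        rw [norm_mul]
        exact mul_le_mul (hS fun k => hM k z) (hM i z) (norm_nonneg _) (by positivity))
  have b3 : Integrable (fun z => P z * (∑ i, u i z * fderiv ℝ ψ z (ev i))) := by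
    have hm : Measurable (fun z => ∑ i, u i z * fderiv ℝ ψ z (ev i)) :=
      Finset.measurable_fun_sum _ fun i _ => (hum i).mul (hdψ _).measurable
    refine hP.mul_bdd (c := ∑ i, M * Bd (ev i)) hm.aestronglyMeasurable
      (Eventually.of_forall fun z => ?_)
    refine (norm_sum_le _ _).trans (Finset.sum_le_sum fun i _ => ?_)
    rw [norm_mul]
    exact mul_le_mul (hM i z) (hBd _ z) (norm_nonneg _) hM0
  have b4s := integrable_finsetSum (μ := (volume : Measure (SpT d))) Finset.univ fun k _ => b4 k
  have c4s := fun n => integrable_finsetSum (μ := (volume : Measure (SpT d))) Finset.univ fun k _ => c4 n k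
  rw [integral_add4 b1 b2 b3 b4s]
  simp_rw [fun n => integral_add4 (c1 n) (c2 n) (c3 n) (c4s n)]
  exact ((t1.add t2).add t3).add t4

lemma rhs_tendsto {u : Fin d → SpT d → ℝ} {M : ℝ}
    (hM : ∀ i z, |u i z| ≤ M)
    (hu : ∀ i, LocallyIntegrable (u i)) (huu : ∀ i j, LocallyIntegrable (fun z => u i z * u j z))
    (hM0 : 0 ≤ M) (Eu : Fin d → Fin d → SignedMeasure (SpT d))
    {ψ : SpT d → ℝ} (hψcont : Continuous ψ) (hψc : HasCompactSupport ψ) :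
    ∃ b : ℕ → ℝ, Tendsto b atTop (𝓝 (∑ i, ∑ j, 2 * M ^ 2 *
        ∫ z, |ψ z| ∂((Eu i j).singularPart volume).totalVariation)) ∧
      ∀ n, |∫ z, ψ z * ∑ i, ∑ j, (mol n (u i) z * mol n (u j) z - mol n (fun y => u i y * u j y) z)
        * sintegral (fun y => rho (SpT d) n (z - y)) (Eu i j)| ≤ b n := by
  have hAc : ∀ n i, Continuous (mol n (u i)) := fun n i => (mol_contDiff n (hu i)).continuous
  have hQc : ∀ n i j, Continuous (mol n (fun y => u i y * u j y)) :=
    fun n i j => (mol_contDiff n (huu i j)).continuous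
  have hA : ∀ n i z, |mol n (u i) z| ≤ M := fun n i z => mol_abs_le n (hM i) z
  have hQ : ∀ n i j z, |mol n (fun y => u i y * u j y) z| ≤ M ^ 2 := fun n i j z =>
    mol_abs_le n (fun z => by
      rw [abs_mul, pow_two]; exact mul_le_mul (hM i z) (hM j z) (abs_nonneg _) hM0) z
  obtain ⟨R, hR⟩ : ∃ R : ℕ → Fin d → Fin d → SpT d → ℝ, ∀ n i j z, R n i j z =
      mol n (u i) z * mol n (u j) z - mol n (fun y => u i y * u j y) z := ⟨_, fun _ _ _ _ => rfl⟩
  simp_rw [← hR]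
  have hRc : ∀ n i j, Continuous (R n i j) := fun n i j => by
    rw [funext (hR n i j)]; fun_prop
  have hRb : ∀ n i j z, |R n i j z| ≤ 2 * M ^ 2 := by
    intro n i j z
    rw [hR]
    refine (abs_sub _ _).trans ?_
    have : |mol n (u i) z * mol n (u j) z| ≤ M * M := by
      rw [abs_mul]
      exact mul_le_mul (hA n i z) (hA n j z) (abs_nonneg _) hM0
    linarith [hQ n i j z]
  have hRl : ∀ i j, ∀ᵐ z, Tendsto (fun n => R n i j z) atTop (𝓝 0) := by
    intro i j
    filter_upwards [mol_ae_tendsto (hu i), mol_ae_tendsto (hu j), mol_ae_tendsto (huu i j)] with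
      z h1 h2 h3
    simp_rw [hR]
    simpa using (h1.mul h2).sub h3
  clear hR
  obtain ⟨B0, hB0⟩ := hψc.exists_bound_of_continuous hψcont
  have hB00 : 0 ≤ B0 := (norm_nonneg _).trans (hB0 0)
  let g : Fin d → Fin d → SpT d → ℝ := fun i j z => (Eu i j).rnDeriv volume z
  have hg : ∀ i j, Integrable (g i j) := fun i j => SignedMeasure.integrable_rnDeriv _ _
  have hga : ∀ i j, Integrable (fun z => |g i j z|) := fun i j => (hg i j).abs
  let ν : Fin d → Fin d → Measure (SpT d) := fun i j =>
    ((Eu i j).singularPart volume).totalVariation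
  have hν : ∀ i j, IsFiniteMeasure (ν i j) := fun i j => by
    dsimp only [ν]; infer_instance
  have hψa : Continuous (fun z => |ψ z|) := hψcont.abs
  have hψac : HasCompactSupport (fun z => |ψ z|) := hψc.norm
  have hm := fun i j => tendsto_mol_measure (μ := ν i j) hψa hψac
  have i1 : ∀ n i j, Integrable (fun z => mol n (fun z => |g i j z|) z * |ψ z * R n i j z|) := by
    intro n i j
    refine (mol_integrable n (hga i j)).mul_bdd (c := B0 * (2 * M ^ 2))
      ((hψcont.mul (hRc n i j)).abs).aestronglyMeasurable (Eventually.of_forall fun z => ?_)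
    rw [Real.norm_eq_abs, abs_abs, abs_mul]
    exact mul_le_mul (hB0 z) (hRb n i j z) (abs_nonneg _) hB00
  have i2 : ∀ n i j, Integrable (fun z => 2 * M ^ 2 *
      (|ψ z| * ∫ y, rho (SpT d) n (z - y) ∂(ν i j))) := fun n i j => ((hm i j).1 n).const_mul _
  have i3 : ∀ n i j, Integrable (fun z => mol n (fun z => |g i j z|) z * |ψ z * R n i j z| + 2 * M ^ 2 *
      (|ψ z| * ∫ y, rho (SpT d) n (z - y) ∂(ν i j))) := fun n i j => (i1 n i j).add (i2 n i j)
  refine ⟨fun n => ∫ z, ∑ i, ∑ j, (mol n (fun z => |g i j z|) z * |ψ z * R n i j z| + 2 * M ^ 2 *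
      (|ψ z| * ∫ y, rho (SpT d) n (z - y) ∂(ν i j))), ?_, ?_⟩
  · have e : ∀ n, ∫ z, ∑ i, ∑ j, (mol n (fun z => |g i j z|) z * |ψ z * R n i j z| + 2 * M ^ 2 *
      (|ψ z| * ∫ y, rho (SpT d) n (z - y) ∂(ν i j))) =
      ∑ i, ∑ j, ((∫ z, mol n (fun z => |g i j z|) z * |ψ z * R n i j z|) + 2 * M ^ 2 *
        ∫ z, |ψ z| * ∫ y, rho (SpT d) n (z - y) ∂(ν i j)) := by
      intro n
      rw [integral_finsetSum _ fun i _ => integrable_finsetSum _ fun j _ => i3 n i j]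
      refine Finset.sum_congr rfl fun i _ => ?_
      rw [integral_finsetSum _ fun j _ => i3 n i j]
      refine Finset.sum_congr rfl fun j _ => ?_
      rw [integral_add (i1 n i j) (i2 n i j), integral_const_mul]
    simp_rw [e]
    refine tendsto_finsetSum _ fun i _ => tendsto_finsetSum _ fun j _ => ?_
    have h1 : Tendsto (fun n => ∫ z, mol n (fun z => |g i j z|) z * |ψ z * R n i j z|) atTop
        (𝓝 (∫ z, |g i j z| * 0)) := by
      refine tendsto_mol_mul (hga i j) (w := fun n z => |ψ z * R n i j z|) (w' := fun _ => 0)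
        (B := B0 * (2 * M ^ 2)) ?_ ?_ ?_
      · exact fun n => ((hψcont.mul (hRc n i j)).abs).aestronglyMeasurable
      · intro n z
        rw [abs_abs, abs_mul]
        exact mul_le_mul (hB0 z) (hRb n i j z) (abs_nonneg _) hB00
      · filter_upwards [hRl i j] with z hz
        simpa using (hz.const_mul (ψ z)).abs
    have := h1.add (((hm i j).2).const_mul (2 * M ^ 2))
    simpa using this
  · intro n
    beta_reduce
    rw [← Real.norm_eq_abs]
    refine norm_integral_le_of_norm_le (integrable_finsetSum _ fun i _ =>
      integrable_finsetSum _ fun j _ => i3 n i j) (Eventually.of_forall fun z => ?_)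
    rw [Finset.mul_sum]
    refine (norm_sum_le _ _).trans (Finset.sum_le_sum fun i _ => ?_)
    rw [Finset.mul_sum]
    refine (norm_sum_le _ _).trans (Finset.sum_le_sum fun j _ => ?_)
    obtain ⟨Br, hBr⟩ := rho_bdd (G := SpT d) n
    have hrm : Measurable (fun y => rho (SpT d) n (z - y)) :=
      ((rho_cont n).comp (continuous_const.sub continuous_id)).measurable
    have hrb : ∀ y, |rho (SpT d) n (z - y)| ≤ Br := fun y => hBr _
    have hE : sintegral (fun y => rho (SpT d) n (z - y)) (Eu i j) =
        sintegral (fun y => rho (SpT d) n (z - y)) ((Eu i j).singularPart volume)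
          + mol n (g i j) z := by
      conv_lhs => rw [← SignedMeasure.singularPart_add_withDensity_rnDeriv_eq (s := Eu i j) (μ := volume)]
      rw [sintegral_add hrm hrb, sintegral_withDensity (hg i j) hrm hrb, mol_apply]
    have hs := abs_sintegral_le ((Eu i j).singularPart volume) hrm hrb
    simp_rw [abs_of_nonneg (rho_nonneg n _)] at hs
    have hgm : |mol n (g i j) z| ≤ mol n (fun z => |g i j z|) z := by
      rw [mol_apply, mol_apply]
      refine (abs_integral_le_integral_abs).trans (le_of_eq ?_)
      congr 1; ext y
      rw [abs_mul, abs_of_nonneg (rho_nonneg n _)]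
    have hgm0 := (abs_nonneg _).trans hgm
    have hs0 := (abs_nonneg _).trans hs
    rw [hE, Real.norm_eq_abs, ← mul_assoc, abs_mul]
    calc |ψ z * R n i j z| * |sintegral (fun y => rho (SpT d) n (z - y)) ((Eu i j).singularPart volume)
          + mol n (g i j) z|
        ≤ |ψ z * R n i j z| * ((∫ y, rho (SpT d) n (z - y) ∂(ν i j)) + mol n (fun z => |g i j z|) z) := by
          gcongr
          exact (abs_add_le _ _).trans (add_le_add hs hgm)
      _ = mol n (fun z => |g i j z|) z * |ψ z * R n i j z|
          + |R n i j z| * (|ψ z| * ∫ y, rho (SpT d) n (z - y) ∂(ν i j)) := by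
          rw [abs_mul]; ring
      _ ≤ _ := by
          gcongr
          exact hRb n i j z

lemma key_bound {Ω : Set (EuclideanSpace ℝ (Fin d))} (hΩ : IsOpen Ω) {T : ℝ}
    {u : Fin d → SpT d → ℝ} {P : SpT d → ℝ} {F : Fin d → SpT d → ℝ} {M : ℝ}
    (hum : ∀ i, Measurable (u i)) (hM : ∀ i z, |u i z| ≤ M) (hM0 : 0 ≤ M)
    (hP : Integrable P) (hF : ∀ i, Integrable (F i))
    (hmom : ∀ ψ, IsTest Ω T ψ → ∀ k,
      ∫ z, (u k z * fderiv ℝ ψ z tv + ∑ i, (u i z * u k z) * fderiv ℝ ψ z (ev i)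
        + P z * fderiv ℝ ψ z (ev k) + F k z * ψ z) = 0)
    (hdiv : ∀ ψ, IsTest Ω T ψ → ∫ z, ∑ i, u i z * fderiv ℝ ψ z (ev i) = 0)
    {Eu : Fin d → Fin d → SignedMeasure (SpT d)}
    (hEu : ∀ i j, ∀ ψ, IsTest Ω T ψ → sintegral ψ (Eu i j) =
      -(1 / 2) * ∫ z, (u i z * fderiv ℝ ψ z (ev j) + u j z * fderiv ℝ ψ z (ev i)))
    {ψ : SpT d → ℝ} (hψ : IsTest Ω T ψ) :
    |∫ z, (((∑ k, u k z ^ 2) / 2 * fderiv ℝ ψ z tv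
        + ∑ i, ((∑ k, u k z ^ 2) / 2 * u i z) * fderiv ℝ ψ z (ev i))
        + P z * (∑ i, u i z * fderiv ℝ ψ z (ev i))
        + ∑ k, F k z * (u k z * ψ z))| ≤ ∑ i, ∑ j, 2 * M ^ 2 *
        ∫ z, |ψ z| ∂((Eu i j).singularPart volume).totalVariation := by
  have loc : ∀ {q : SpT d → ℝ} {B : ℝ}, Measurable q → (∀ z, |q z| ≤ B) → LocallyIntegrable q := by
    intro q B hq hB
    exact (locallyIntegrable_const B).mono hq.aestronglyMeasurable
      (Eventually.of_forall fun z => (hB z).trans (le_abs_self B))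
  have hu : ∀ i, LocallyIntegrable (u i) := fun i => loc (hum i) (hM i)
  have huu : ∀ i j, LocallyIntegrable (fun z => u i z * u j z) := fun i j =>
    loc (B := M * M) ((hum i).mul (hum j)) fun z => by
      rw [abs_mul]; exact mul_le_mul (hM i z) (hM j z) (abs_nonneg _) hM0
  have h1 := lhs_tendsto hum hM hu huu hP hF hM0 hψ.1 hψ.2.1
  obtain ⟨b, hb, hle⟩ := rhs_tendsto hM hu huu hM0 Eu hψ.1.continuous hψ.2.1
  obtain ⟨δ, hδ, hsub⟩ := hψ.2.1.exists_cthickening_subset_open (hΩ.prod isOpen_Ioo) hψ.2.2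
  refine le_of_tendsto_of_tendsto h1.abs hb ?_
  have hev : ∀ᶠ n : ℕ in atTop, 1 / ((n : ℝ) + 1) < δ :=
    tendsto_one_div_add_atTop_nhds_zero_nat.eventually (gt_mem_nhds hδ)
  filter_upwards [hev] with n hn
  rw [energy_id hu huu hP.locallyIntegrable (fun i => (hF i).locallyIntegrable) hmom hdiv hEu hψ n
    fun z hz => ((closedBall_subset_closedBall hn.le).trans
      (closedBall_subset_cthickening hz δ)).trans hsub]
  exact hle n

end Key

section Final
open Filter

/-- The space of test functions. -/
def testSpace (Ω : Set (EuclideanSpace ℝ (Fin d))) (T : ℝ) : Submodule ℝ (SpT d → ℝ) where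
  carrier := {ψ | IsTest Ω T ψ}
  zero_mem' := ⟨contDiff_const, HasCompactSupport.zero, by
    have : tsupport (0 : SpT d → ℝ) = ∅ := tsupport_eq_empty_iff.2 rfl
    change tsupport (0 : SpT d → ℝ) ⊆ _
    rw [this]; exact Set.empty_subset _⟩
  add_mem' := fun {a b} ha hb => ⟨ha.1.add hb.1, ha.2.1.add hb.2.1,
    (tsupport_add a b).trans (Set.union_subset ha.2.2 hb.2.2)⟩
  smul_mem' := fun c a ha => ⟨ha.1.const_smul c, ha.2.1.smul_left (f := fun _ => c),
    (tsupport_smul_subset_right (fun _ => c) a).trans ha.2.2⟩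

lemma exists_lin {Ω : Set (EuclideanSpace ℝ (Fin d))} {T : ℝ} {a c : SpT d → ℝ}
    {b : Fin d → SpT d → ℝ} (ha : LocallyIntegrable a) (hb : ∀ i, LocallyIntegrable (b i))
    (hc : LocallyIntegrable c) :
    ∃ L : testSpace Ω T →ₗ[ℝ] ℝ, ∀ ψ : testSpace Ω T, L ψ =
      ∫ z, (a z * fderiv ℝ ψ.1 z tv + (∑ i, b i z * fderiv ℝ ψ.1 z (ev i)) + c z * ψ.1 z) := by
  have hIntg : ∀ ψ : testSpace Ω T, Integrable (fun z => a z * fderiv ℝ ψ.1 z tv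
      + (∑ i, b i z * fderiv ℝ ψ.1 z (ev i)) + c z * ψ.1 z) := by
    intro ψ
    have h1 := int_mul_fderiv ha ψ.2.1 ψ.2.2.1 tv
    have h2 := fun i => int_mul_fderiv (hb i) ψ.2.1 ψ.2.2.1 (ev i)
    have h3 := int_mul_test hc ψ.2.1.continuous ψ.2.2.1
    exact (h1.add (integrable_finsetSum _ fun i _ => h2 i)).add h3
  have hd : ∀ (ψ : testSpace Ω T) z, DifferentiableAt ℝ ψ.1 z := fun ψ z =>
    ψ.2.1.differentiable (by simp) z
  refine ⟨{ toFun := fun ψ => ∫ z, (a z * fderiv ℝ ψ.1 z tv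
      + (∑ i, b i z * fderiv ℝ ψ.1 z (ev i)) + c z * ψ.1 z), map_add' := ?_, map_smul' := ?_ },
      fun ψ => rfl⟩
  · intro ψ φ
    rw [← integral_add (hIntg ψ) (hIntg φ)]
    congr 1; ext z
    have e : fderiv ℝ (ψ + φ).1 z = fderiv ℝ ψ.1 z + fderiv ℝ φ.1 z :=
      fderiv_add (hd ψ z) (hd φ z)
    have e2 : (ψ + φ).1 z = ψ.1 z + φ.1 z := rfl
    rw [e, e2]
    simp only [ContinuousLinearMap.add_apply, mul_add, Finset.sum_add_distrib]
    ring
  · intro r ψ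
    rw [RingHom.id_apply, smul_eq_mul, ← integral_const_mul]
    congr 1; ext z
    have e : fderiv ℝ (r • ψ).1 z = r • fderiv ℝ ψ.1 z := fderiv_const_smul (hd ψ z) r
    have e2 : (r • ψ).1 z = r * ψ.1 z := rfl
    rw [e, e2]
    simp only [ContinuousLinearMap.smul_apply, smul_eq_mul, mul_add, Finset.mul_sum]
    congr 1
    · congr 1
      · ring
      · exact Finset.sum_congr rfl fun i _ => by ring
    · ring

end Final

/-- For a bounded weak solution `u` (with `p, f ∈ L¹`) of the incompressible
Euler equations on `Ω × (0,T)` whose spatial symmetric gradient `Eu` is a finite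
matrix-valued measure, the Duchon–Robert distribution `D` (defined by the local energy
balance) is a (signed) Radon measure and locally `|D| ≤ C |E^s u|`, where `E^s u` is the
singular part of `Eu` with respect to `ℒ^{d+1}`. -/
theorem stmt13 (Ω : Set (EuclideanSpace ℝ (Fin d))) (hΩ : IsOpen Ω) (T : ℝ) (hT : 0 < T)
    (u : EuclideanSpace ℝ (Fin d) × ℝ → EuclideanSpace ℝ (Fin d))
    (p : EuclideanSpace ℝ (Fin d) × ℝ → ℝ)
    (f : EuclideanSpace ℝ (Fin d) × ℝ → EuclideanSpace ℝ (Fin d))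
    (humeas : Measurable u) (M : ℝ) (hubdd : ∀ z, ‖u z‖ ≤ M)
    (hp : IntegrableOn p (Ω ×ˢ Set.Ioo 0 T) volume)
    (hf : IntegrableOn f (Ω ×ˢ Set.Ioo 0 T) volume)
    -- weak formulation of the momentum equation
    (hmom : ∀ φ : EuclideanSpace ℝ (Fin d) × ℝ → EuclideanSpace ℝ (Fin d),
      ContDiff ℝ ∞ φ → HasCompactSupport φ → tsupport φ ⊆ Ω ×ˢ Set.Ioo 0 T →
      ∫ z, (⟪u z, fderiv ℝ φ z (0, 1)⟫
        + ∑ i, ∑ j, u z i * u z j * (fderiv ℝ φ z (EuclideanSpace.single i 1, 0)) j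
        + p z * ∑ i, (fderiv ℝ φ z (EuclideanSpace.single i 1, 0)) i
        + ⟪f z, φ z⟫) = 0)
    -- incompressibility
    (hdiv : ∀ ψ : EuclideanSpace ℝ (Fin d) × ℝ → ℝ, IsTest Ω T ψ →
      ∫ z, ∑ i, u z i * dX i ψ z = 0)
    -- the spatial symmetric gradient is a finite matrix-valued measure
    (Eu : Fin d → Fin d → MeasureTheory.SignedMeasure (EuclideanSpace ℝ (Fin d) × ℝ))
    (hEu : ∀ i j, ∀ ψ : EuclideanSpace ℝ (Fin d) × ℝ → ℝ, IsTest Ω T ψ →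
      sintegral ψ (Eu i j) = -(1 / 2) * ∫ z, (u z i * dX j ψ z + u z j * dX i ψ z)) :
    ∃ D : MeasureTheory.SignedMeasure (EuclideanSpace ℝ (Fin d) × ℝ),
      (∀ ψ : EuclideanSpace ℝ (Fin d) × ℝ → ℝ, IsTest Ω T ψ →
        ∫ z, ((‖u z‖ ^ 2 / 2) * dT ψ z
          + (‖u z‖ ^ 2 / 2 + p z) * ∑ i, u z i * dX i ψ z
          + ⟪f z, u z⟫ * ψ z) = sintegral ψ D) ∧
      (∀ K : Set (EuclideanSpace ℝ (Fin d) × ℝ), IsCompact K → K ⊆ Ω ×ˢ Set.Ioo 0 T →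
        ∃ C : NNReal, 0 < C ∧ ∀ s : Set (EuclideanSpace ℝ (Fin d) × ℝ),
          MeasurableSet s → s ⊆ K →
          D.totalVariation s
            ≤ C * ∑ i, ∑ j, ((Eu i j).singularPart volume).totalVariation s) := by
  have hM0 : 0 ≤ M := (norm_nonneg _).trans (hubdd 0)
  set U : Set (SpT d) := Ω ×ˢ Set.Ioo 0 T with hU
  have hUo : IsOpen U := hΩ.prod isOpen_Ioo
  let P : SpT d → ℝ := U.indicator p
  let F : Fin d → SpT d → ℝ := fun k => U.indicator (fun z => f z k)
  let v : Fin d → SpT d → ℝ := fun k z => u z k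
  have hvm : ∀ k, Measurable (v k) := fun k =>
    (EuclideanSpace.proj (𝕜 := ℝ) k).continuous.measurable.comp humeas
  have hvM : ∀ k z, |v k z| ≤ M := fun k z => (PiLp.norm_apply_le (u z) k).trans (hubdd z)
  have hP : Integrable P := hp.integrable_indicator hUo.measurableSet
  have hF : ∀ k, Integrable (F k) := fun k => by
    have : IntegrableOn (fun z => f z k) U :=
      (EuclideanSpace.proj (𝕜 := ℝ) k).integrable_comp hf
    exact this.integrable_indicator hUo.measurableSet
  have hmom' : ∀ ψ, IsTest Ω T ψ → ∀ k,
      ∫ z, (v k z * fderiv ℝ ψ z tv + ∑ i, (v i z * v k z) * fderiv ℝ ψ z (ev i)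
        + P z * fderiv ℝ ψ z (ev k) + F k z * ψ z) = 0 := by
    intro ψ hψ k
    have h := hmom (fun z => ψ z • EuclideanSpace.single k (1 : ℝ))
      (hψ.1.smul contDiff_const) (hψ.2.1.smul_right)
      ((tsupport_smul_subset_left ψ (fun _ => EuclideanSpace.single k (1 : ℝ))).trans hψ.2.2)
    rw [← h]
    congr 1; ext z
    have hder : ∀ w, fderiv ℝ (fun z => ψ z • EuclideanSpace.single k (1 : ℝ)) z w
        = fderiv ℝ ψ z w • EuclideanSpace.single k (1 : ℝ) := by
      intro w
      rw [fderiv_smul_const (hψ.1.differentiable (by simp) z)]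
      rfl
    have e1 : ∀ i, ∑ j, u z i * u z j * (fderiv ℝ ψ z (EuclideanSpace.single i 1, 0) •
        EuclideanSpace.single k (1 : ℝ) : EuclideanSpace ℝ (Fin d)) j
        = v i z * v k z * fderiv ℝ ψ z (ev i) := by
      intro i
      rw [Finset.sum_eq_single k]
      · simp [v, ev]
      · intro j _ hj
        simp [hj]
      · simp
    have e2 : ∑ i, (fderiv ℝ ψ z (EuclideanSpace.single i 1, 0) •
        EuclideanSpace.single k (1 : ℝ) : EuclideanSpace ℝ (Fin d)) i = fderiv ℝ ψ z (ev k) := by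
      rw [Finset.sum_eq_single k]
      · simp [ev]
      · intro j _ hj
        simp [hj]
      · simp
    simp only [hder]
    rw [e2, Finset.sum_congr rfl fun i _ => e1 i]
    rw [inner_smul_right, inner_smul_right, EuclideanSpace.inner_single_right,
      EuclideanSpace.inner_single_right]
    by_cases hz : z ∈ U
    · simp only [P, F, Set.indicator_of_mem hz]
      simp [v, tv]
      ring
    · have hz' : z ∉ tsupport ψ := fun h => hz (hψ.2.2 h)
      simp [fderiv_zero_of_notMem hz', image_eq_zero_of_notMem_tsupport hz']
  have hkey := fun {ψ : SpT d → ℝ} (hψ : IsTest Ω T ψ) =>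
    key_bound (Eu := Eu) hΩ hvm hvM hM0 hP hF hmom' hdiv hEu hψ
  have loc : ∀ {q : SpT d → ℝ} {B : ℝ}, Measurable q → (∀ z, |q z| ≤ B) → LocallyIntegrable q := by
    intro q B hq hB
    exact (locallyIntegrable_const B).mono hq.aestronglyMeasurable
      (Filter.Eventually.of_forall fun z => (hB z).trans (le_abs_self B))
  have hnsq : ∀ z, |‖u z‖ ^ 2 / 2| ≤ M ^ 2 := fun z => by
    rw [abs_of_nonneg (by positivity)]
    have := pow_le_pow_left₀ (norm_nonneg _) (hubdd z) 2
    nlinarith [sq_nonneg ‖u z‖]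
  have hnm : Measurable fun z => ‖u z‖ ^ 2 / 2 := (humeas.norm.pow_const 2).div_const 2
  have ha : LocallyIntegrable (fun z => ‖u z‖ ^ 2 / 2) := loc hnm hnsq
  have hb : ∀ i, LocallyIntegrable (fun z => (‖u z‖ ^ 2 / 2) * v i z + P z * v i z) := by
    intro i
    have h1 : LocallyIntegrable (fun z => (‖u z‖ ^ 2 / 2) * v i z) :=
      loc (B := M ^ 2 * M) (hnm.mul (hvm i)) fun z => by
        rw [abs_mul]
        exact mul_le_mul (hnsq z) (hvM i z) (abs_nonneg _) (by positivity)
    have h2 : Integrable (fun z => P z * v i z) :=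
      hP.mul_bdd (c := M) (hvm i).aestronglyMeasurable (Filter.Eventually.of_forall (hvM i))
    exact h1.add h2.locallyIntegrable
  have hc : LocallyIntegrable (fun z => ∑ k, F k z * v k z) := by
    refine Integrable.locallyIntegrable (integrable_finsetSum _ fun k _ => ?_)
    exact (hF k).mul_bdd (c := M) (hvm k).aestronglyMeasurable (Filter.Eventually.of_forall (hvM k))
  obtain ⟨L, hL⟩ := exists_lin (Ω := Ω) (T := T) ha hb hc
  have hnorm : ∀ z, ‖u z‖ ^ 2 = ∑ k, v k z ^ 2 := fun z => by
    rw [EuclideanSpace.real_norm_sq_eq]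
  have hLkey : ∀ ψ : testSpace Ω T, L ψ = ∫ z, (((∑ k, v k z ^ 2) / 2 * fderiv ℝ ψ.1 z tv
        + ∑ i, ((∑ k, v k z ^ 2) / 2 * v i z) * fderiv ℝ ψ.1 z (ev i))
        + P z * (∑ i, v i z * fderiv ℝ ψ.1 z (ev i))
        + ∑ k, F k z * (v k z * ψ.1 z)) := by
    intro ψ
    rw [hL]
    congr 1; ext z
    rw [hnorm]
    simp only [add_mul, Finset.sum_add_distrib, Finset.mul_sum, Finset.sum_mul, mul_assoc]
    ring
  have hLst : ∀ ψ : testSpace Ω T, L ψ = ∫ z, ((‖u z‖ ^ 2 / 2) * dT ψ.1 z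
          + (‖u z‖ ^ 2 / 2 + p z) * ∑ i, u z i * dX i ψ.1 z
          + ⟪f z, u z⟫ * ψ.1 z) := by
    intro ψ
    rw [hL]
    congr 1; ext z
    by_cases hz : z ∈ U
    · have hi : ⟪f z, u z⟫ = ∑ k, F k z * v k z := by
        rw [PiLp.inner_apply]
        refine Finset.sum_congr rfl fun k _ => ?_
        simp only [F, Set.indicator_of_mem hz, v]
        simp [mul_comm]
      rw [hi]
      have hPz : P z = p z := Set.indicator_of_mem hz _
      simp only [hPz, dT, dX, ev, tv, v, Finset.mul_sum]
      congr 2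
      exact Finset.sum_congr rfl fun i _ => by ring
    · have hz' : z ∉ tsupport ψ.1 := fun h => hz (ψ.2.2.2 h)
      simp [dT, dX, fderiv_zero_of_notMem hz', image_eq_zero_of_notMem_tsupport hz']
  let ν : Fin d → Fin d → Measure (SpT d) := fun i j =>
    ((Eu i j).singularPart volume).totalVariation
  have hν : ∀ i j, IsFiniteMeasure (ν i j) := fun i j => by
    dsimp only [ν]; infer_instance
  let μ : Measure (SpT d) := ∑ i, ∑ j, ν i j
  have hμ : IsFiniteMeasure μ := by dsimp only [μ]; infer_instance
  let C : NNReal := ⟨2 * M ^ 2 + 1, by positivity⟩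
  have hCval : (C : ℝ) = 2 * M ^ 2 + 1 := rfl
  have hVb : ∀ φ ∈ testSpace Ω T, Measurable φ ∧ ∃ B, ∀ x, |φ x| ≤ B := fun φ hφ =>
    ⟨hφ.1.continuous.measurable, hφ.2.1.exists_bound_of_continuous hφ.1.continuous⟩
  obtain ⟨D, hD1, hD2⟩ := exists_signed (μ := μ) C (testSpace Ω T) hVb L (fun φ => by
    have h1 := (le_abs_self _).trans (hkey φ.2)
    rw [← hLkey φ] at h1
    refine h1.trans ?_
    obtain ⟨hm, B, hB⟩ := hVb φ.1 φ.2
    have hIntg : ∀ i j, Integrable (fun x => |φ.1 x|) (ν i j) := fun i j =>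
      Integrable.of_bound hm.abs.aestronglyMeasurable B
        (Filter.Eventually.of_forall fun x => by rw [Real.norm_eq_abs, abs_abs]; exact hB x)
    have e : ∫ x, |φ.1 x| ∂μ = ∑ i, ∑ j, ∫ x, |φ.1 x| ∂(ν i j) := by
      dsimp only [μ]
      rw [integral_finsetSum_measure fun i _ => integrable_finsetSum_measure.2 fun j _ => hIntg i j]
      refine Finset.sum_congr rfl fun i _ => ?_
      rw [integral_finsetSum_measure fun j _ => hIntg i j]
    rw [e, hCval, Finset.mul_sum]
    refine Finset.sum_le_sum fun i _ => ?_
    rw [Finset.mul_sum]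
    refine Finset.sum_le_sum fun j _ => ?_
    exact mul_le_mul_of_nonneg_right (by linarith) (integral_nonneg fun x => abs_nonneg _))
  refine ⟨D, fun ψ hψ => ?_, fun K _ _ => ⟨C, ?_, fun s hs _ => ?_⟩⟩
  · rw [← hLst ⟨ψ, hψ⟩, hD1]
  · rw [← NNReal.coe_pos, hCval]; positivity
  · refine (totalVariation_le_of C hD2 hs).trans (le_of_eq ?_)
    simp [μ, ν, Measure.finsetSum_apply]

end
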